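/- arXiv:2308.13361 — 3 statements merged into one kernel-verified Lean document; each statement's English description precedes it below -/
import Mathlib

section
/- Let p ∈ [1,∞), let Ω ⊆ X be open, (Y,d_Y) a metric space, and f ∈ 𝔅(Ω,Y). Then: (i) E_p[f](Ω) = sup{E_p[f](Ω') : Ω' ⊆ Ω open with Ω' ⋐ Ω}; and (ii) E_p[f](Ω) = sup over all families ((Ω_j, φ_j))_{j∈ℕ} — where the Ω_j are pairwise disjoint open subsets of Ω and each φ_j : Y → ℝ is bounded 1-Lipschitz — of Σ_{j=1}^∞ E_p[φ_j∘f](Ω_j). -/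
open MeasureTheory Filter Metric Set Topology
open scoped ENNReal NNReal

noncomputable section

namespace BBM

variable {X : Type*} [MetricSpace X]

/-- The closed `r`-neighborhood of a set `S`: the set of points at distance at most `r`
from `S`. -/
def setBall (S : Set X) (r : ℝ) : Set X :=
  {x : X | EMetric.infEdist x S ≤ ENNReal.ofReal r}

/-- The (extended) distance, computed in the metric completion `X̄` of `X`, from a set
`S ⊆ X` to the complement `X̄ \ S₀` of a set `S₀ ⊆ X`. -/
def compDist (S S₀ : Set X) : ℝ≥0∞ :=
  ⨅ (x : X) (_ : x ∈ S) (z : UniformSpace.Completion X)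
    (_ : z ∉ (fun a : X => (a : UniformSpace.Completion X)) '' S₀),
    edist (x : UniformSpace.Completion X) z

/-- `S ⋐ S₀` : the set `S` is well contained in `S₀`, i.e. `S ⊆ S₀` and the distance
from `S` to `X̄ \ S₀` (computed in the completion `X̄`) is positive. -/
def WellInside (S S₀ : Set X) : Prop := S ⊆ S₀ ∧ 0 < compDist S S₀

/-- The local Lipschitz constant (slope) of `u` at `x`, relative to the domain `Ω`.
If `x` is not a limit point of `Ω`, the filter below is trivial and the value is `0`. -/
def lipAt (Ω : Set X) (u : X → ℝ) (x : X) : ℝ≥0∞ :=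
  Filter.limsup (fun x' => ENNReal.ofReal (|u x' - u x| / dist x' x)) (𝓝[Ω \ {x}] x)

/-- `u` is locally Lipschitz on `Ω`: each point of `Ω` has a closed ball inside `Ω`
on which `u` is Lipschitz. -/
def LocLipschitzOn (Ω : Set X) (u : X → ℝ) : Prop :=
  ∀ x ∈ Ω, ∃ r > 0, ∃ K : NNReal, closedBall x r ⊆ Ω ∧ LipschitzOnWith K u (closedBall x r)

variable [MeasurableSpace X]

/-- `u ∈ L^p_loc(E)` : `u` is Borel and `p`-integrable near every point of `E`. -/
def MemLpLocOn (m : Measure X) (p : ℝ) (E : Set X) (u : X → ℝ) : Prop :=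
  Measurable u ∧ ∀ x ∈ E, ∃ r > 0,
    ∫⁻ x' in E ∩ closedBall x r, ENNReal.ofReal |u x'| ^ p ∂m < ⊤

/-- Convergence of a sequence `v n` to `u` in `L^p_loc(E)`. -/
def TendstoLpLoc (m : Measure X) (p : ℝ) (E : Set X) (v : ℕ → X → ℝ) (u : X → ℝ) : Prop :=
  ∀ x ∈ E, ∃ r > 0,
    Tendsto (fun n => ∫⁻ x' in E ∩ closedBall x r, ENNReal.ofReal |v n x' - u x'| ^ p ∂m)
      atTop (𝓝 0)

/-- Cheeger `p`-energy of a real valued function on an open set `Ω'`, defined by relaxation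
along sequences of locally Lipschitz functions converging in `L^p_loc(Ω')`. -/
def cheegerOpen (m : Measure X) (p : ℝ) (u : X → ℝ) (Ω' : Set X) : ℝ≥0∞ :=
  ⨅ (v : ℕ → X → ℝ) (_ : ∀ n, LocLipschitzOn Ω' (v n)) (_ : TendstoLpLoc m p Ω' v u),
    Filter.liminf (fun n => ∫⁻ x in Ω', lipAt Ω' (v n) x ^ p ∂m) atTop

/-- Cheeger `p`-energy of a real valued function on an arbitrary subset `S` of `Ω`:
infimum over open sets `Ω'` with `S ⊆ Ω' ⊆ Ω`. -/
def cheegerSet (m : Measure X) (p : ℝ) (Ω : Set X) (u : X → ℝ) (S : Set X) : ℝ≥0∞ :=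
  ⨅ (Ω' : Set X) (_ : IsOpen Ω') (_ : Ω' ⊆ Ω) (_ : S ⊆ Ω'), cheegerOpen m p u Ω'

/-- `φ` is a bounded `1`-Lipschitz real function. -/
def BddLip1 {Y : Type*} [PseudoMetricSpace Y] (φ : Y → ℝ) : Prop :=
  (∃ C, ∀ y, |φ y| ≤ C) ∧ LipschitzWith 1 φ

/-- `ν` is a Borel-regular outer measure: Borel sets are Carathéodory-measurable and every
set is contained in a Borel set with the same measure. -/
def IsBorelRegularOM (ν : OuterMeasure X) : Prop :=
  (∀ B : Set X, MeasurableSet B → ν.IsCaratheodory B) ∧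
  ∀ S : Set X, ∃ B : Set X, MeasurableSet B ∧ S ⊆ B ∧ ν S = ν B

/-- `ν` is the Cheeger `p`-energy of the metric-space-valued map `f` on `Ω`: the least
Borel-regular outer measure dominating `S ↦ E_p[φ ∘ f](S)` for all bounded `1`-Lipschitz
`φ : Y → ℝ` and all `S ⊆ Ω`. -/
def IsCheegerEnergy (m : Measure X) (p : ℝ) (Ω : Set X) {Y : Type*} [MetricSpace Y]
    (f : X → Y) (ν : OuterMeasure X) : Prop :=
  IsBorelRegularOM ν ∧
  (∀ S, S ⊆ Ω → ∀ φ : Y → ℝ, BddLip1 φ → cheegerSet m p Ω (φ ∘ f) S ≤ ν S) ∧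
  ∀ ν' : OuterMeasure X, IsBorelRegularOM ν' →
    (∀ S, S ⊆ Ω → ∀ φ : Y → ℝ, BddLip1 φ → cheegerSet m p Ω (φ ∘ f) S ≤ ν' S) →
    ∀ S, S ⊆ Ω → ν S ≤ ν' S

/-- `f ∈ 𝔅(E, Y)` : `f` is Borel (w.r.t. the Borel σ-algebra of `Y`) on `E` and essentially
separably valued on `E`. -/
def MemB (m : Measure X) (E : Set X) {Y : Type*} [MetricSpace Y] (f : X → Y) : Prop :=
  (@Measurable E Y _ (borel Y) fun x : E => f x) ∧
  ∃ N : Set X, N ⊆ E ∧ m N = 0 ∧ TopologicalSpace.IsSeparable (f '' (E \ N))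

/-- `f ∈ L^p(E, Y)`. -/
def MemLpY (m : Measure X) (p : ℝ) (E : Set X) {Y : Type*} [MetricSpace Y] (f : X → Y) :
    Prop :=
  MemB m E f ∧ ∃ y : Y, ∫⁻ x in E, edist (f x) y ^ p ∂m < ⊤

/-- `f ∈ L^p_loc(E, Y)`. -/
def MemLpLocY (m : Measure X) (p : ℝ) (E : Set X) {Y : Type*} [MetricSpace Y] (f : X → Y) :
    Prop :=
  MemB m E f ∧ ∃ y : Y, ∀ x ∈ E, ∃ r > 0,
    ∫⁻ x' in E ∩ closedBall x r, edist (f x') y ^ p ∂m < ⊤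

/-- `f ∈ S^{1,p}(Ω, Y)` : `f ∈ 𝔅(Ω,Y)`, the Cheeger `p`-energy of `f` is finite on `Ω` and
absolutely continuous with respect to `m` restricted to `Ω`. -/
def MemSobolevClass (m : Measure X) (p : ℝ) (Ω : Set X) {Y : Type*} [MetricSpace Y]
    (f : X → Y) : Prop :=
  MemB m Ω f ∧ ∃ ν : OuterMeasure X, IsCheegerEnergy m p Ω f ν ∧ ν Ω < ⊤ ∧
    ∀ S, S ⊆ Ω → m S = 0 → ν S = 0

/-- The doubling property on the `R`-neighborhood of `S`, at scales up to `R`. -/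
def DoublingOn (m : Measure X) (C_D : NNReal) (S : Set X) (R : ℝ) : Prop :=
  ∀ x ∈ setBall S R, ∀ r : ℝ, 0 < r → r ≤ R →
    0 < m (closedBall x (2 * r)) ∧
    m (closedBall x (2 * r)) ≤ (C_D : ℝ≥0∞) * m (closedBall x r) ∧
    m (closedBall x r) < ⊤

/-- `X` is internally doubling with constant `C_D`. -/
def InternallyDoubling (m : Measure X) (C_D : NNReal) : Prop :=
  1 ≤ C_D ∧ ∀ S : Set X, WellInside S univ → ∃ R > 0, DoublingOn m C_D S R

/-- The `p`-Poincaré property on the `R`-neighborhood of `S`, at scales up to `R`. -/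
def PoincareOn (m : Measure X) (p C_P lam : ℝ) (S : Set X) (R : ℝ) : Prop :=
  (∀ x ∈ setBall S R, ∀ r : ℝ, 0 < r → r ≤ lam * R →
      0 < m (closedBall x r) ∧ m (closedBall x r) < ⊤) ∧
  ∀ u : X → ℝ, (∃ K : NNReal, LipschitzWith K u) →
    ∀ x ∈ setBall S R, ∀ r : ℝ, 0 < r → r ≤ R →
      (m (closedBall x r))⁻¹ *
          ∫⁻ x' in closedBall x r,
            ENNReal.ofReal |u x' - ⨍ x'' in closedBall x r, u x'' ∂m| ∂m ≤
        ENNReal.ofReal (C_P * r) *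
          ((m (closedBall x (lam * r)))⁻¹ *
              ∫⁻ x' in closedBall x (lam * r), lipAt univ u x' ^ p ∂m) ^ (1 / p)

/-- `X` supports an internal `p`-Poincaré inequality with constants `C_P`, `lam`. -/
def InternalPoincare (m : Measure X) (p C_P lam : ℝ) : Prop :=
  0 < C_P ∧ 1 ≤ lam ∧ ∀ S : Set X, WellInside S univ → ∃ R > 0, PoincareOn m p C_P lam S R

/-- `σ(δ, x, r)` : supremum of `ρ δ x ·` outside the closed ball `B(x,r)` (zero if the
complement is empty). -/
def sigmaM (ρ : ℝ → X → X → NNReal) (δ : ℝ) (x : X) (r : ℝ) : ℝ≥0∞ :=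
  ⨆ x' ∈ (closedBall x r)ᶜ, (ρ δ x x' : ℝ≥0∞)

/-- Absolute difference in `ℝ≥0∞`. -/
def eabs (a b : ℝ≥0∞) : ℝ≥0∞ := (a - b) ⊔ (b - a)

/-- The quantities `Π_{L,k}(δ,x,r,h)`. -/
def PiL (m : Measure X) (ρ : ℝ → X → X → NNReal) (p δ : ℝ) (x : X) (r h : ℝ) : ℕ → ℝ≥0∞
  | 0 => sigmaM ρ δ x r * m (closedBall x (r / h)) * ENNReal.ofReal (r / h) ^ p
  | k + 1 =>
      eabs (sigmaM ρ δ x (r / h ^ (k + 1))) (sigmaM ρ δ x (r / h ^ k)) *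
        m (closedBall x (r / h ^ (k + 2))) * ENNReal.ofReal (r / h ^ (k + 2)) ^ p

/-- The quantities `Π_{U,k}(δ,x,r,h)`. -/
def PiU (m : Measure X) (ρ : ℝ → X → X → NNReal) (p δ : ℝ) (x : X) (r h : ℝ) : ℕ → ℝ≥0∞
  | 0 => sigmaM ρ δ x r * m (closedBall x r) * ENNReal.ofReal r ^ p
  | k + 1 =>
      eabs (sigmaM ρ δ x (r / h ^ (k + 1))) (sigmaM ρ δ x (r / h ^ k)) *
        m (closedBall x (r / h ^ (k + 1))) * ENNReal.ofReal (r / h ^ (k + 1)) ^ p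

/-- The family `(ρ_δ)_{δ ∈ (0,1)}` is `p`-admissible with constant `C_M`. -/
def PAdmissible (m : Measure X) (p : ℝ) (ρ : ℝ → X → X → NNReal) (C_M : NNReal) : Prop :=
  (∀ δ ∈ Ioo (0:ℝ) 1, Measurable fun q : X × X => ρ δ q.1 q.2) ∧
  (Filter.limsup (fun r : ℝ => Filter.limsup (fun δ : ℝ =>
      ⨆ x : X, ∫⁻ x' in (closedBall x r)ᶜ, ((ρ δ x x' : ℝ≥0∞) + (ρ δ x' x : ℝ≥0∞)) ∂m)
      (𝓝[>] (0:ℝ))) (𝓝[>] (0:ℝ)) = 0) ∧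
  (∀ x : X, Filter.limsup (fun r : ℝ => Filter.limsup (fun δ : ℝ => sigmaM ρ δ x r)
      (𝓝[>] (0:ℝ))) (𝓝[>] (0:ℝ)) = 0) ∧
  (∀ δ ∈ Ioo (0:ℝ) 1, ∀ x x₁ x₂ : X, dist x x₁ ≤ dist x x₂ → ρ δ x x₂ ≤ ρ δ x x₁) ∧
  (∀ x : X, ∀ δ ∈ Ioo (0:ℝ) 1,
      Filter.limsup (fun r : ℝ => sigmaM ρ δ x r * m (closedBall x r) * ENNReal.ofReal r ^ p)
        (𝓝[>] (0:ℝ)) = 0) ∧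
  1 ≤ C_M ∧
  ∀ S : Set X, S.Nonempty → WellInside S univ →
    ((C_M : ℝ≥0∞))⁻¹ ≤ Filter.liminf (fun r : ℝ => Filter.liminf (fun δ : ℝ =>
        ∑' k, ⨅ x ∈ S, PiL m ρ p δ x r 2 k) (𝓝[>] (0:ℝ))) (𝓝[>] (0:ℝ)) ∧
    Filter.limsup (fun r : ℝ => Filter.limsup (fun δ : ℝ =>
        ∑' k, ⨆ x ∈ S, PiU m ρ p δ x r 2 k) (𝓝[>] (0:ℝ))) (𝓝[>] (0:ℝ)) ≤ (C_M : ℝ≥0∞)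

/-- The family `(ρ_δ)_{δ ∈ (0,1)}` is strongly `p`-admissible with constant `C_M` and
function `Θ`. -/
def StronglyPAdmissible (m : Measure X) (p : ℝ) (ρ : ℝ → X → X → NNReal) (C_M : NNReal)
    (Θ : X → ℝ≥0∞) : Prop :=
  PAdmissible m p ρ C_M ∧
  (∀ S : Set X, S.Nonempty → WellInside S univ → ∀ h : ℝ, 1 < h →
      Filter.limsup (fun r : ℝ => Filter.limsup (fun δ : ℝ =>
          ∑' k, ⨆ x ∈ S, PiU m ρ p δ x r h k) (𝓝[>] (0:ℝ))) (𝓝[>] (0:ℝ)) < ⊤) ∧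
  Measurable Θ ∧ (∀ x, Θ x < ⊤) ∧
  Filter.limsup (fun h : ℝ => essSup (fun x : X =>
      Filter.limsup (fun r : ℝ => Filter.limsup (fun δ : ℝ =>
          eabs (Θ x) (∑' k, PiL m ρ p δ x r h k) + eabs (Θ x) (∑' k, PiU m ρ p δ x r h k))
        (𝓝[>] (0:ℝ))) (𝓝[>] (0:ℝ))) m) (𝓝[>] (1:ℝ)) = 0

/-- The Korevaar–Schoen approximate `p`-energy density `ks_p[f,E](x,r)`. -/
def ks (m : Measure X) (p : ℝ) {Y : Type*} [PseudoEMetricSpace Y] (f : X → Y) (E : Set X)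
    (x : X) (r : ℝ) : ℝ≥0∞ :=
  (m (closedBall x r))⁻¹ *
    ∫⁻ x' in closedBall x r ∩ E, edist (f x) (f x') ^ p / ENNReal.ofReal r ^ p ∂m

/-- The averaging operator `A_p[f](x,r)` applied to an energy (outer) measure `ν`. -/
def Aop (m : Measure X) (ν : OuterMeasure X) (x : X) (r : ℝ) : ℝ≥0∞ :=
  if m (closedBall x r) = 0 then 0 else ν (closedBall x r) / m (closedBall x r)

/-- The (modified) Riesz potential `R_p[f](x,r)` applied to an energy measure `ν`. -/
def Rop (m : Measure X) (ν : OuterMeasure X) (x : X) (r : ℝ) : ℝ≥0∞ :=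
  (3 : ℝ≥0∞)⁻¹ * ∑' k : ℕ, (2 / 3 : ℝ≥0∞) ^ k * Aop m ν x (r / 2 ^ k)

/-- The maximal function `M_p[f](x,r)` applied to an energy measure `ν`. -/
def Mop (m : Measure X) (ν : OuterMeasure X) (x : X) (r : ℝ) : ℝ≥0∞ :=
  ⨆ r' ∈ Ioc (0:ℝ) r, Aop m ν x r'

/-- `x` is a density point of `E` (and lies in the support of `m`). -/
def IsDensityPoint (m : Measure X) (E : Set X) (x : X) : Prop :=
  (∀ r : ℝ, 0 < r → 0 < m (ball x r)) ∧
  Tendsto (fun r : ℝ => m (E ∩ closedBall x r) / m (closedBall x r)) (𝓝[>] (0:ℝ)) (𝓝 1)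

/-- `f` has the Luzin–Lipschitz property on `E`. -/
def LuzinLipschitzOn (m : Measure X) (E : Set X) {Y : Type*} [PseudoEMetricSpace Y]
    (f : X → Y) : Prop :=
  ∃ E' : ℕ → Set X, (∀ k, MeasurableSet (E' k) ∧ E' k ⊆ E) ∧ m (E \ ⋃ k, E' k) = 0 ∧
    ∀ k, ∃ K : NNReal, LipschitzOnWith K f (E' k)

/-- A strongly rectifiable atlas with accuracy `ε`: pieces `U i`, dimensions `d i`,
`(1+ε)`-biLipschitz charts `ψ i`, and pushforward measures equal to `c i · θ i · Lebesgue`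
on the chart images. -/
def RectAtlas (m : Measure X) (ε : ℝ) (d : ℕ → ℕ) (U : ℕ → Set X)
    (ψ : (i : ℕ) → X → EuclideanSpace ℝ (Fin (d i))) (c : ℕ → ℝ)
    (θ : (i : ℕ) → EuclideanSpace ℝ (Fin (d i)) → ℝ) : Prop :=
  (∀ i, MeasurableSet (U i)) ∧ Pairwise (Function.onFun Disjoint U) ∧
  m (Set.univ \ ⋃ i, U i) = 0 ∧
  (∀ i, ∀ x ∈ U i, ∀ y ∈ U i,
      dist x y ≤ (1 + ε) * dist (ψ i x) (ψ i y) ∧ dist (ψ i x) (ψ i y) ≤ (1 + ε) * dist x y) ∧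
  (∀ i, 0 < c i) ∧ (∀ i, Measurable (θ i)) ∧ (∀ i v, θ i v ∈ Set.Icc (1 + ε)⁻¹ (1 + ε)) ∧
  ∀ i, ∀ A : Set (EuclideanSpace ℝ (Fin (d i))), MeasurableSet A →
    m (U i ∩ ψ i ⁻¹' A) = ∫⁻ v in A ∩ ψ i '' U i, ENNReal.ofReal (c i * θ i v)

/-- `X` (with measure `m`) is strongly rectifiable. -/
def StronglyRectifiable (m : Measure X) : Prop :=
  ∀ ε ∈ Ioo (0:ℝ) 1, ∃ d U ψ c θ, RectAtlas m ε d U ψ c θ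

/-- `Dim` is a dimensional decomposition function for the strongly rectifiable space `X`. -/
def IsDimensionFunction (m : Measure X) (Dim : X → ℕ) : Prop :=
  Measurable Dim ∧ ∀ ε ∈ Ioo (0:ℝ) 1, ∃ d U ψ c θ, RectAtlas m ε d U ψ c θ ∧
    ∀ i, m {x ∈ U i | Dim x ≠ d i} = 0

/-- The data of a good extension: `ι` is an isometric embedding of `Y` into `Z` and
`F ∈ L^p(X, Z)` has finite Cheeger `p`-energy `ν` on `X`, coincides `m`-a.e. on `Ω`
with `ι ∘ f`, and `E_p[F](B(Ω,r)) → E_p[F](Ω)` as `r ↘ 0`. -/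
def IsGoodExtension (m : Measure X) (p : ℝ) (Ω : Set X) {Y : Type*} [MetricSpace Y]
    {Z : Type*} [MetricSpace Z] (f : X → Y) (ι : Y → Z) (F : X → Z) : Prop :=
  Isometry ι ∧ MemLpY m p Set.univ F ∧
  ∃ ν : OuterMeasure X, IsCheegerEnergy m p Set.univ F ν ∧ ν Set.univ < ⊤ ∧
    (∀ᵐ x ∂m.restrict Ω, F x = ι (f x)) ∧
    Tendsto (fun r : ℝ => ν (setBall Ω r)) (𝓝[>] (0:ℝ)) (𝓝 (ν Ω))

/-- The open set `Ω` has the strong `p`-extension property. -/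
def StrongPExtension (m : Measure X) (p : ℝ) (Ω : Set X) : Prop :=
  ∀ (Y : Type) [MetricSpace Y] (f : X → Y),
    MemLpY m p Ω f → (∃ ν : OuterMeasure X, IsCheegerEnergy m p Ω f ν ∧ ν Ω < ⊤) →
    ∃ (Z : Type) (iZ : MetricSpace Z) (ι : Y → Z) (F : X → Z),
      @IsGoodExtension X _ _ m p Ω Y _ Z iZ f ι F


set_option linter.unusedSectionVars false

lemma lipAt_eq {U : Set X} {x : X} (hU : U ∈ 𝓝 x) (v : X → ℝ) :
    lipAt U v x = Filter.limsup (fun x' => ENNReal.ofReal (|v x' - v x| / dist x' x)) (𝓝[≠] x) := by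
  have : 𝓝[U \ {x}] x = 𝓝[≠] x := by
    rw [sdiff_eq]
    exact nhdsWithin_inter_of_mem (mem_nhdsWithin_of_mem_nhds hU)
  rw [lipAt, this]

/-- Asymptotic Lipschitz bound. -/
def LipB (v : X → ℝ) (x : X) (g : ℝ) : Prop :=
  ∀ ε > 0, ∀ᶠ x' in 𝓝 x, |v x' - v x| ≤ (g + ε) * dist x' x

lemma LipB.congr {v w : X → ℝ} {x : X} {g : ℝ} (h : LipB v x g) (e : w =ᶠ[𝓝 x] v) :
    LipB w x g := by
  intro ε hε
  filter_upwards [h ε hε, e] with y hy ey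
  rw [ey, e.self_of_nhds]; exact hy

lemma LipB.zero (x : X) : LipB (fun _ => (0:ℝ)) x 0 := by
  intro ε hε
  filter_upwards with y
  simp; positivity

lemma LipB.add {v w : X → ℝ} {x : X} {g h : ℝ} (hv : LipB v x g) (hw : LipB w x h) :
    LipB (fun y => v y + w y) x (g + h) := by
  intro ε hε
  filter_upwards [hv (ε/2) (by positivity), hw (ε/2) (by positivity)] with y h1 h2
  calc |v y + w y - (v x + w x)| = |(v y - v x) + (w y - w x)| := by ring_nf
    _ ≤ |v y - v x| + |w y - w x| := abs_add_le _ _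
    _ ≤ (g + ε/2) * dist y x + (h + ε/2) * dist y x := add_le_add h1 h2
    _ = _ := by ring

lemma LipB.sum {v : ℕ → X → ℝ} {x : X} {g : ℕ → ℝ} (s : Finset ℕ)
    (hv : ∀ i ∈ s, LipB (v i) x (g i)) :
    LipB (fun y => ∑ i ∈ s, v i y) x (∑ i ∈ s, g i) := by
  classical
  induction s using Finset.induction_on with
  | empty => simpa using LipB.zero x
  | insert a s ha ih =>
    simp only [Finset.sum_insert ha]
    exact (hv a (by simp)).add (ih fun i hi => hv i (by simp [hi]))

lemma LipB.add_const {v : X → ℝ} {x : X} {g : ℝ} (h : LipB v x g) (c : ℝ) :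
    LipB (fun y => v y + c) x g := by
  intro ε hε
  filter_upwards [h ε hε] with y hy
  simpa using hy

lemma LipB.mul {ψ v : X → ℝ} {x : X} {g : ℝ} {L : ℝ≥0}
    (h : LipB v x g) (hψ : LipschitzWith L ψ) (hψ0 : 0 ≤ ψ x) (c : ℝ)
    (hc : ContinuousAt v x) :
    LipB (fun y => ψ y * (v y - c)) x (ψ x * g + L * |v x - c|) := by
  intro ε hε
  set δ := ε / (ψ x + L + 1) with hδ
  have hpos : 0 < ψ x + L + 1 := by positivity
  have hδ0 : 0 < δ := by positivity
  have hcc : ∀ᶠ y in 𝓝 x, |v y - c| < |v x - c| + δ := by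
    have : ContinuousAt (fun y => |v y - c|) x := (hc.sub continuousAt_const).abs
    exact this.eventually (gt_mem_nhds (by linarith))
  filter_upwards [h δ hδ0, hcc] with y h1 h2
  have h3 : |ψ y - ψ x| ≤ L * dist y x := by
    have := hψ.dist_le_mul y x
    rwa [Real.dist_eq] at this
  calc |ψ y * (v y - c) - ψ x * (v x - c)|
      = |ψ x * (v y - v x) + (ψ y - ψ x) * (v y - c)| := by ring_nf
    _ ≤ |ψ x * (v y - v x)| + |(ψ y - ψ x) * (v y - c)| := abs_add_le _ _
    _ = ψ x * |v y - v x| + |ψ y - ψ x| * |v y - c| := by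
        rw [abs_mul, abs_mul, abs_of_nonneg hψ0]
    _ ≤ ψ x * ((g + δ) * dist y x) + (L * dist y x) * (|v x - c| + δ) := by gcongr
    _ = (ψ x * g + L * |v x - c| + δ * (ψ x + L)) * dist y x := by ring
    _ ≤ (ψ x * g + L * |v x - c| + ε) * dist y x := by
        gcongr
        rw [hδ, div_mul_eq_mul_div, div_le_iff₀ hpos]
        nlinarith

lemma LipB.lipAt_le {U : Set X} {v : X → ℝ} {x : X} {g : ℝ} (hU : U ∈ 𝓝 x) (hg : 0 ≤ g)
    (h : LipB v x g) : lipAt U v x ≤ ENNReal.ofReal g := by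
  rw [lipAt_eq hU]
  refine ENNReal.le_of_forall_pos_le_add fun ε hε _ => ?_
  refine limsup_le_of_le (by isBoundedDefault) ?_
  filter_upwards [mem_nhdsWithin_of_mem_nhds (h ε hε), self_mem_nhdsWithin] with y hy hne
  have : (ε : ℝ≥0∞) = ENNReal.ofReal ε := by simp
  rw [this, ← ENNReal.ofReal_add hg (by positivity)]
  apply ENNReal.ofReal_le_ofReal
  exact (div_le_iff₀ (dist_pos.2 hne)).2 hy

lemma lipB_of_lipAt {U : Set X} {v : X → ℝ} {x : X} (hU : U ∈ 𝓝 x) 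
    (h : lipAt U v x ≠ ⊤) : LipB v x (lipAt U v x).toReal := by
  intro ε hε
  have h1 : lipAt U v x < ENNReal.ofReal ((lipAt U v x).toReal + ε) := by
    rw [ENNReal.lt_ofReal_iff_toReal_lt h]; linarith
  have h2 := lipAt_eq hU v ▸ h1
  have h3 := eventually_lt_of_limsup_lt h2
  rw [← lipAt_eq hU v] at h3
  rw [eventually_nhdsWithin_iff] at h3
  filter_upwards [h3] with y hy
  by_cases hne : y = x
  · subst hne; simp
  · have := hy hne
    rw [ENNReal.ofReal_lt_ofReal_iff (by positivity), div_lt_iff₀ (dist_pos.2 hne)] at this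
    exact this.le

lemma LocLipschitzOn.lipAt_ne_top {U : Set X} {v : X → ℝ} (h : LocLipschitzOn U v) {x : X}
    (hx : x ∈ U) (hU : IsOpen U) : lipAt U v x ≠ ⊤ := by
  obtain ⟨r, hr, K, -, hK⟩ := h x hx
  have : LipB v x K := by
    intro ε hε
    filter_upwards [closedBall_mem_nhds x hr] with y hy
    have := hK.dist_le_mul y hy x (mem_closedBall_self hr.le)
    rw [Real.dist_eq] at this
    nlinarith [dist_nonneg (x := y) (y := x)]
  exact ((this.lipAt_le (hU.mem_nhds hx) K.2).trans_lt ENNReal.ofReal_lt_top).ne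

lemma LocLipschitzOn.continuousAt {U : Set X} {v : X → ℝ} (h : LocLipschitzOn U v) {x : X}
    (hx : x ∈ U) : ContinuousAt v x := by
  obtain ⟨r, hr, K, -, hK⟩ := h x hx
  exact hK.continuousOn.continuousAt (closedBall_mem_nhds x hr)

lemma measurable_lipAt [BorelSpace X] {U : Set X} (hU : IsOpen U)
    {v : X → ℝ} (hv : ContinuousOn v U) : Measurable (U.indicator (lipAt U v)) := by
  have key : U.indicator (lipAt U v) = fun x => ⨅ n : ℕ, U.indicator (fun x =>
      ⨆ y ∈ {y | y ∈ U ∧ y ≠ x ∧ dist y x < 1 / ((n:ℝ) + 1)},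
        ENNReal.ofReal (|v y - v x| / dist y x)) x := by
    funext x
    by_cases hx : x ∈ U
    · simp only [indicator_of_mem hx]
      have hb : (𝓝[U \ {x}] x).HasBasis (fun _ : ℕ => True)
          (fun n => ball x (1 / ((n:ℝ) + 1)) ∩ (U \ {x})) :=
        nhdsWithin_hasBasis nhds_basis_ball_inv_nat_succ _
      rw [lipAt, hb.limsup_eq_iInf_iSup]
      simp only [iInf_true]
      congr 1; funext n; congr 1; funext y
      refine iSup_congr_Prop ?_ fun _ => rfl
      simp only [mem_inter_iff, mem_ball, Set.mem_sdiff, mem_singleton_iff, mem_ofPred_eq]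
      tauto
    · simp [indicator_of_notMem hx]
  rw [key]
  refine Measurable.iInf fun n => ?_
  refine measurable_of_Ioi fun c => ?_
  refine IsOpen.measurableSet ?_
  rw [isOpen_iff_mem_nhds]
  intro x hx
  simp only [mem_preimage, mem_Ioi] at hx
  have hxU : x ∈ U := by
    by_contra hc; rw [indicator_of_notMem hc] at hx; exact not_lt_bot hx
  rw [indicator_of_mem hxU] at hx
  simp only [lt_iSup_iff] at hx
  obtain ⟨y, ⟨hyU, hyx, hd⟩, hlt⟩ := hx
  have hvx : ContinuousAt v x := hv.continuousAt (hU.mem_nhds hxU)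
  have hdc : ContinuousAt (fun z => dist y z) x := by fun_prop
  have hq : ContinuousAt (fun z => ENNReal.ofReal (|v y - v z| / dist y z)) x := by
    apply ENNReal.continuous_ofReal.continuousAt.comp
    exact ((continuousAt_const.sub hvx).abs).div hdc (dist_pos.2 hyx).ne'
  filter_upwards [hU.mem_nhds hxU, hq.eventually (lt_mem_nhds hlt),
    hdc.eventually (gt_mem_nhds hd), hdc.eventually (lt_mem_nhds (dist_pos.2 hyx))] with z h1 h2 h3 h4
  simp only [mem_preimage, mem_Ioi, indicator_of_mem h1, lt_iSup_iff]
  exact ⟨y, ⟨hyU, dist_pos.1 h4, h3⟩, h2⟩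

lemma LocLipschitzOn.mono {U V : Set X} {v : X → ℝ} (h : LocLipschitzOn V v) (hU : IsOpen U)
    (hUV : U ⊆ V) : LocLipschitzOn U v := by
  intro x hx
  obtain ⟨r, hr, K, -, hK⟩ := h x (hUV hx)
  obtain ⟨s, hs, hsU⟩ := Metric.nhds_basis_closedBall.mem_iff.1 (hU.mem_nhds hx)
  exact ⟨min r s, lt_min hr hs, K, (closedBall_subset_closedBall (min_le_right _ _)).trans hsU,
    hK.mono (closedBall_subset_closedBall (min_le_left _ _))⟩

lemma cheegerOpen_mono [BorelSpace X] (m : Measure X) (p : ℝ) (u : X → ℝ)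
    {U V : Set X} (hU : IsOpen U) (hV : IsOpen V) (hUV : U ⊆ V) :
    cheegerOpen m p u U ≤ cheegerOpen m p u V := by
  unfold cheegerOpen
  refine le_iInf fun v => le_iInf fun h1 => le_iInf fun h2 => ?_
  refine iInf_le_of_le v <| iInf_le_of_le (fun n => (h1 n).mono hU hUV) <| iInf_le_of_le ?_ ?_
  · intro x hx
    obtain ⟨r, hr, ht⟩ := h2 x (hUV hx)
    refine ⟨r, hr, tendsto_of_tendsto_of_tendsto_of_le_of_le tendsto_const_nhds ht
      (fun _ => zero_le) fun n => ?_⟩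
    exact lintegral_mono_set (inter_subset_inter_left _ hUV)
  · refine liminf_le_liminf (Eventually.of_forall fun n => ?_)
    calc ∫⁻ x in U, lipAt U (v n) x ^ p ∂m = ∫⁻ x in U, lipAt V (v n) x ^ p ∂m := by
          refine setLIntegral_congr_fun hU.measurableSet fun x hx => ?_
          rw [lipAt_eq (hU.mem_nhds hx), lipAt_eq (hV.mem_nhds (hUV hx))]
      _ ≤ _ := lintegral_mono_set hUV

lemma cheegerOpen_congr [BorelSpace X] (m : Measure X) (p : ℝ) {u u' : X → ℝ}
    {U : Set X} (hU : IsOpen U) (h : EqOn u u' U) :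
    cheegerOpen m p u U = cheegerOpen m p u' U := by
  have : ∀ v, TendstoLpLoc m p U v u ↔ TendstoLpLoc m p U v u' := by
    intro v
    unfold TendstoLpLoc
    have : ∀ x r n, ∫⁻ x' in U ∩ closedBall x r, ENNReal.ofReal |v n x' - u x'| ^ p ∂m =
        ∫⁻ x' in U ∩ closedBall x r, ENNReal.ofReal |v n x' - u' x'| ^ p ∂m := by
      intro x r n
      refine setLIntegral_congr_fun (hU.measurableSet.inter measurableSet_closedBall)
        fun y hy => ?_
      simp only [h hy.1]
    simp only [this]
  unfold cheegerOpen
  simp only [this]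

lemma cheegerSet_eq [BorelSpace X] (m : Measure X) (p : ℝ) (u : X → ℝ)
    {U Ω : Set X} (hU : IsOpen U) (hUΩ : U ⊆ Ω) :
    cheegerSet m p Ω u U = cheegerOpen m p u U := by
  apply le_antisymm
  · exact iInf_le_of_le U <| iInf_le_of_le hU <| iInf_le_of_le hUΩ <| iInf_le_of_le le_rfl le_rfl
  · exact le_iInf fun V => le_iInf fun hV => le_iInf fun _ => le_iInf fun h =>
      cheegerOpen_mono m p u hU hV h

/-- Locally Lipschitz at a point. -/
def LL (x : X) (h : X → ℝ) : Prop := ∃ r > 0, ∃ K : ℝ≥0, LipschitzOnWith K h (closedBall x r)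

lemma LL.sum {x : X} {h : ℕ → X → ℝ} (s : Finset ℕ) (H : ∀ i ∈ s, LL x (h i)) :
    LL x (fun y => ∑ i ∈ s, h i y) := by
  classical
  induction s using Finset.induction_on with
  | empty => exact ⟨1, one_pos, 0, by simpa using (LipschitzWith.const (0:ℝ)).lipschitzOnWith⟩
  | insert a s ha ih =>
    simp only [Finset.sum_insert ha]
    obtain ⟨r, hr, K, hK⟩ := H a (by simp)
    obtain ⟨r', hr', K', hK'⟩ := ih fun i hi => H i (by simp [hi])
    exact ⟨min r r', lt_min hr hr', K + K',
      (hK.mono (closedBall_subset_closedBall (min_le_left _ _))).add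
      (hK'.mono (closedBall_subset_closedBall (min_le_right _ _)))⟩

lemma LL.congr {x : X} {h k : X → ℝ} (H : LL x h) (e : k =ᶠ[𝓝 x] h) : LL x k := by
  obtain ⟨r, hr, K, hK⟩ := H
  obtain ⟨s, hs, hsU⟩ := Metric.nhds_basis_closedBall.mem_iff.1 e
  refine ⟨min r s, lt_min hr hs, K, fun a ha b hb => ?_⟩
  have h1 := closedBall_subset_closedBall (x := x) (min_le_right r s)
  have h2 := closedBall_subset_closedBall (x := x) (min_le_left r s)
  have ea : k a = h a := hsU (h1 ha)
  have eb : k b = h b := hsU (h1 hb)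
  rw [ea, eb]
  exact hK (h2 ha) (h2 hb)

lemma LL.mul {x : X} {ψ v : X → ℝ} {L : ℝ≥0} (H : LL x v) (hψ : LipschitzWith L ψ)
    (h0 : ∀ y, 0 ≤ ψ y) (h1 : ∀ y, ψ y ≤ 1) : LL x (fun y => ψ y * v y) := by
  obtain ⟨r, hr, K, hK⟩ := H
  refine ⟨r, hr, K + L * (Real.toNNReal (|v x| + K * r)), LipschitzOnWith.of_dist_le_mul
    fun a ha b hb => ?_⟩
  have e1 := hK.dist_le_mul a ha b hb
  have e2 := hK.dist_le_mul b hb x (mem_closedBall_self hr.le)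
  have e3 := hψ.dist_le_mul a b
  rw [Real.dist_eq] at e1 e2 e3 ⊢
  have e4 : |v b| ≤ |v x| + K * r := by
    have : |v b| ≤ |v x| + |v b - v x| := by
      have := abs_add_le (v x) (v b - v x); simpa using this
    have h5 : K * dist b x ≤ K * r := by gcongr; exact hb
    linarith
  push_cast
  rw [Real.coe_toNNReal _ (by positivity)]
  calc |ψ a * v a - ψ b * v b| = |ψ a * (v a - v b) + (ψ a - ψ b) * v b| := by ring_nf
    _ ≤ |ψ a * (v a - v b)| + |(ψ a - ψ b) * v b| := abs_add_le _ _
    _ = ψ a * |v a - v b| + |ψ a - ψ b| * |v b| := by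
        rw [abs_mul, abs_mul, abs_of_nonneg (h0 a)]
    _ ≤ 1 * (K * dist a b) + (L * dist a b) * (|v x| + K * r) := by
        gcongr; exact h1 a
    _ = _ := by ring

lemma exists_partition [TopologicalSpace.SeparableSpace X] {U : Set X}
    (hne : U.Nonempty) (R : X → ℝ) (hR : ∀ x ∈ U, 0 < R x) :
    ∃ (c : ℕ → X) (ψ : ℕ → X → ℝ) (L : ℕ → ℝ≥0), (∀ i, c i ∈ U) ∧ (∀ i x, 0 ≤ ψ i x) ∧
      (∀ i x, ψ i x ≤ 1) ∧ (∀ i, LipschitzWith (L i) (ψ i)) ∧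
      (∀ i x, x ∉ closedBall (c i) (R (c i)) → ψ i x = 0) ∧
      (∀ x ∈ U, ∃ N : ℕ, ∀ᶠ y in 𝓝 x, (∀ i, N ≤ i → ψ i y = 0) ∧
        ∑ i ∈ Finset.range N, ψ i y = 1) ∧
      ∀ (s : Finset ℕ) x, ∑ i ∈ s, ψ i x ≤ 1 := by
  have := UniformSpace.secondCountable_of_separable X
  obtain ⟨t, htU, htc, hcov⟩ := TopologicalSpace.countable_cover_nhdsWithin
    (s := U) (f := fun x => ball x (R x / 2))
    (fun x hx => mem_nhdsWithin_of_mem_nhds (ball_mem_nhds x (half_pos (hR x hx))))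
  have htne : t.Nonempty := by
    obtain ⟨x, hx⟩ := hne
    obtain ⟨y, hy, -⟩ := mem_iUnion₂.1 (hcov hx)
    exact ⟨y, hy⟩
  obtain ⟨c, rfl⟩ := htc.exists_eq_range htne
  have hc : ∀ i, c i ∈ U := fun i => htU (mem_range_self i)
  have hRc : ∀ i, 0 < R (c i) := fun i => hR _ (hc i)
  set η : ℕ → X → ℝ := fun i x => max 0 (min 1 (2 - (2 / R (c i)) * dist x (c i))) with hη
  have η0 : ∀ i x, 0 ≤ η i x := fun i x => le_max_left _ _
  have η1 : ∀ i x, η i x ≤ 1 := fun i x => max_le zero_le_one (min_le_left _ _)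
  have ηL : ∀ i, LipschitzWith (Real.toNNReal (2 / R (c i))) (η i) := by
    intro i
    refine LipschitzWith.const_max (LipschitzWith.const_min ?_ 1) 0
    refine LipschitzWith.of_dist_le_mul fun a b => ?_
    have : (0:ℝ) < 2 / R (c i) := div_pos two_pos (hRc i)
    rw [Real.dist_eq, Real.coe_toNNReal _ this.le]
    have e : (2 - 2 / R (c i) * dist a (c i)) - (2 - 2 / R (c i) * dist b (c i))
      = (2 / R (c i)) * (dist b (c i) - dist a (c i)) := by ring
    rw [e, abs_mul, abs_of_pos this]
    gcongr
    rw [abs_sub_comm]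
    exact abs_dist_sub_le a b (c i)
  have ηin : ∀ i x, x ∈ ball (c i) (R (c i) / 2) → η i x = 1 := by
    intro i x hx
    have h1 : 2 / R (c i) * dist x (c i) ≤ 1 := by
      rw [div_mul_eq_mul_div, div_le_one (hRc i)]
      rw [mem_ball] at hx; linarith
    simp only [hη]
    rw [min_eq_left (by linarith)]; simp
  have ηout : ∀ i x, x ∉ closedBall (c i) (R (c i)) → η i x = 0 := by
    intro i x hx
    have h1 : 2 ≤ 2 / R (c i) * dist x (c i) := by
      rw [div_mul_eq_mul_div, le_div_iff₀ (hRc i)]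
      rw [mem_closedBall, not_le] at hx; linarith
    exact max_eq_left ((min_le_right _ _).trans (by linarith))
  set P : ℕ → X → ℝ := fun i x => ∏ j ∈ Finset.range i, (1 - η j x) with hP
  have Ps : ∀ i x, P (i+1) x = P i x * (1 - η i x) := fun i x => Finset.prod_range_succ _ _
  have P0 : ∀ i x, 0 ≤ P i x := fun i x => Finset.prod_nonneg fun j _ => by linarith [η1 j x]
  have P1 : ∀ i x, P i x ≤ 1 := fun i x =>
    Finset.prod_le_one (fun j _ => by linarith [η1 j x]) fun j _ => by linarith [η0 j x]
  have mulL : ∀ {a b : X → ℝ} {A B : ℝ≥0}, LipschitzWith A a → LipschitzWith B b →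
      (∀ x, |a x| ≤ 1) → (∀ x, |b x| ≤ 1) → LipschitzWith (A + B) (fun x => a x * b x) := by
    intro a b A B ha hb ha1 hb1
    refine LipschitzWith.of_dist_le_mul fun x y => ?_
    have e1 := ha.dist_le_mul x y
    have e2 := hb.dist_le_mul x y
    rw [Real.dist_eq] at e1 e2 ⊢
    push_cast
    calc |a x * b x - a y * b y| = |(a x - a y) * b x + a y * (b x - b y)| := by ring_nf
      _ ≤ |(a x - a y) * b x| + |a y * (b x - b y)| := abs_add_le _ _
      _ = |a x - a y| * |b x| + |a y| * |b x - b y| := by rw [abs_mul, abs_mul]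
      _ ≤ (A * dist x y) * 1 + 1 * (B * dist x y) := by
          gcongr
          · exact hb1 x
          · exact ha1 y
      _ = _ := by ring
  have PL : ∀ i, ∃ K, LipschitzWith K (P i) := by
    intro i
    induction i with
    | zero => exact ⟨0, by simpa [hP] using LipschitzWith.const (1:ℝ)⟩
    | succ i ih =>
      obtain ⟨K, hK⟩ := ih
      have := mulL hK ((LipschitzWith.const (1:ℝ)).sub (ηL i))
        (fun x => by rw [abs_of_nonneg (P0 i x)]; exact P1 i x)
        (fun x => by rw [abs_of_nonneg (by linarith [η1 i x])]; linarith [η0 i x])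
      exact ⟨_, (funext (Ps i) : P (i+1) = _) ▸ this⟩
  have psi : ∀ i, ∃ K, LipschitzWith K (fun x => η i x * P i x) := by
    intro i
    obtain ⟨K, hK⟩ := PL i
    exact ⟨_, mulL (ηL i) hK (fun x => by rw [abs_of_nonneg (η0 i x)]; exact η1 i x)
      (fun x => by rw [abs_of_nonneg (P0 i x)]; exact P1 i x)⟩
  choose L hL using psi
  have tele : ∀ N x, ∑ i ∈ Finset.range N, η i x * P i x = 1 - P N x := by
    intro N x
    induction N with
    | zero => simp [hP]
    | succ N ih => rw [Finset.sum_range_succ, ih, Ps]; ring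
  refine ⟨c, fun i x => η i x * P i x, L, hc, fun i x => mul_nonneg (η0 i x) (P0 i x),
    fun i x => mul_le_one₀ (η1 i x) (P0 i x) (P1 i x), hL, fun i x hx => by simp [ηout i x hx],
    ?_, ?_⟩
  · intro x hx
    obtain ⟨y, ⟨j, rfl⟩, hy⟩ := mem_iUnion₂.1 (hcov hx)
    refine ⟨j + 1, ?_⟩
    filter_upwards [isOpen_ball.mem_nhds hy] with z hz
    have hzero : ∀ i, j + 1 ≤ i → P i z = 0 := fun i hi =>
      Finset.prod_eq_zero (Finset.mem_range.2 (Nat.lt_of_succ_le hi)) (by rw [ηin j z hz]; simp)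
    refine ⟨fun i hi => by simp [hzero i hi], ?_⟩
    rw [tele, hzero _ le_rfl, sub_zero]
  · intro s x
    obtain ⟨N, hN⟩ := s.exists_nat_subset_range
    calc _ ≤ ∑ i ∈ Finset.range N, η i x * P i x :=
          Finset.sum_le_sum_of_subset_of_nonneg hN fun i _ _ => mul_nonneg (η0 i x) (P0 i x)
      _ ≤ 1 := by rw [tele]; linarith [P0 N x]

lemma sub_jensen {p : ℝ} (hp : 1 ≤ p) (s : Finset ℕ) (w z : ℕ → ℝ≥0∞) (hw : ∑ i ∈ s, w i ≤ 1) :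
    (∑ i ∈ s, w i * z i) ^ p ≤ ∑ i ∈ s, w i * z i ^ p := by
  have h := ENNReal.rpow_arith_mean_le_arith_mean_rpow (Finset.insertNone s)
    (fun o => o.elim (1 - ∑ i ∈ s, w i) w) (fun o => o.elim 0 z)
    (by rw [Finset.sum_insertNone]; simp only [Option.elim]; exact tsub_add_cancel_of_le hw) hp
  rw [Finset.sum_insertNone, Finset.sum_insertNone] at h
  simpa [ENNReal.zero_rpow_of_pos (by linarith : (0:ℝ) < p)] using h

lemma pow_ineq {p : ℝ} (hp : 1 ≤ p) {K : ℝ≥0∞} (hK : 1 < K) (hK' : K ≠ ⊤) :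
    ∃ C : ℕ → ℝ≥0∞, (∀ i, C i ≠ ⊤) ∧ ∀ (s : Finset ℕ) (w g b : ℕ → ℝ≥0∞),
      ∑ i ∈ s, w i ≤ 1 → (∑ i ∈ s, (w i * g i + b i)) ^ p ≤
        K ^ (p - 1) * ∑ i ∈ s, w i * g i ^ p + ∑ i ∈ s, C i * b i ^ p := by
  have hp0 : 0 ≤ p := by linarith
  have hK0 : K ≠ 0 := (zero_lt_one.trans hK).ne'
  set t : ℝ≥0∞ := 1 - K⁻¹ with ht
  have hKinv : K⁻¹ < 1 := ENNReal.inv_lt_one.2 hK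
  have ht0 : t ≠ 0 := (tsub_pos_of_lt hKinv).ne'
  have ht1 : t ≠ ⊤ := ne_top_of_le_ne_top ENNReal.one_ne_top tsub_le_self
  set e : ℕ → ℝ≥0∞ := fun i => 2⁻¹ ^ (i + 1) with he
  have he0 : ∀ i, e i ≠ 0 := fun i => pow_ne_zero _ (by simp)
  have he1 : ∀ i, e i ≠ ⊤ := fun i => ENNReal.pow_ne_top (by simp)
  have hes : ∀ s : Finset ℕ, ∑ i ∈ s, e i ≤ 1 := by
    intro s
    refine (ENNReal.sum_le_tsum s).trans ?_
    rw [he]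
    simp only [ENNReal.tsum_geometric_add_one, ENNReal.one_sub_inv_two, inv_inv]
    rw [ENNReal.inv_mul_cancel (by simp) (by simp)]
  refine ⟨fun i => t * t⁻¹ ^ p * (e i * (e i)⁻¹ ^ p), fun i => ?_, ?_⟩
  · refine ENNReal.mul_ne_top (ENNReal.mul_ne_top ht1 ?_) (ENNReal.mul_ne_top (he1 i) ?_)
    · exact ENNReal.rpow_ne_top_of_nonneg hp0 (ENNReal.inv_ne_top.2 ht0)
    · exact ENNReal.rpow_ne_top_of_nonneg hp0 (ENNReal.inv_ne_top.2 (he0 i))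
  · intro s w g b hw
    set A := ∑ i ∈ s, w i * g i
    set B := ∑ i ∈ s, b i
    have hA : A ^ p ≤ ∑ i ∈ s, w i * g i ^ p := sub_jensen hp s w g hw
    have hB : B ^ p ≤ ∑ i ∈ s, e i * (e i)⁻¹ ^ p * b i ^ p := by
      have := sub_jensen hp s e (fun i => (e i)⁻¹ * b i) (hes s)
      have h1 : ∀ i, e i * ((e i)⁻¹ * b i) = b i := fun i => by
        rw [← mul_assoc, ENNReal.mul_inv_cancel (he0 i) (he1 i), one_mul]
      simp only [h1, ENNReal.mul_rpow_of_nonneg _ _ hp0, ← mul_assoc] at this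
      exact this
    have h2 := ENNReal.rpow_arith_mean_le_arith_mean2_rpow K⁻¹ t (K * A) (t⁻¹ * B)
      (by rw [ht]; exact add_tsub_cancel_of_le hKinv.le) hp
    rw [← mul_assoc, ← mul_assoc, ENNReal.inv_mul_cancel hK0 hK', ENNReal.mul_inv_cancel ht0 ht1,
      one_mul, one_mul, ENNReal.mul_rpow_of_nonneg _ _ hp0, ENNReal.mul_rpow_of_nonneg _ _ hp0,
      ← mul_assoc, ← mul_assoc] at h2
    have h3 : K⁻¹ * K ^ p = K ^ (p - 1) := by
      rw [ENNReal.rpow_sub _ _ hK0 hK', ENNReal.rpow_one, mul_comm, ENNReal.div_eq_inv_mul, mul_comm]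
    rw [Finset.sum_add_distrib]
    refine h2.trans ?_
    rw [h3]
    simp only [mul_assoc, ← Finset.mul_sum]
    simp only [mul_assoc] at hB
    gcongr

lemma exists_approx [BorelSpace X] [TopologicalSpace.SeparableSpace X]
    (m : Measure X) {p : ℝ} (hp : 1 ≤ p) {u : X → ℝ} (hu : Measurable u)
    (W : ℕ → Set X) (hW : ∀ k, IsOpen (W k)) (hne : (⋃ k, W k).Nonempty) {T : ℝ≥0∞}
    (hT : ∑' k, cheegerOpen m p u (W k) < T) {ε : ℝ≥0∞} (hε : 0 < ε) :
    ∃ w : X → ℝ, LocLipschitzOn (⋃ k, W k) w ∧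
      ∫⁻ x in ⋃ k, W k, ENNReal.ofReal |w x - u x| ^ p ∂m ≤ ε ∧
      ∫⁻ x in ⋃ k, W k, lipAt (⋃ k, W k) w x ^ p ∂m ≤ T := by
  have hp0 : 0 < p := by linarith
  set U := ⋃ k, W k with hUdef
  have hU : IsOpen U := isOpen_iUnion hW
  obtain ⟨T1, hT1, hT1T⟩ := exists_between hT
  obtain ⟨T1', hT1', hT1'T⟩ := exists_between hT1T
  obtain ⟨T2, hT2, hT2T⟩ := exists_between hT1'T
  obtain ⟨K, hK1, hKtop, hKT⟩ : ∃ K : ℝ≥0∞, 1 < K ∧ K ≠ ⊤ ∧ K ^ (p - 1) * T1' < T2 := by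
    have hc : Tendsto (fun K : ℝ≥0∞ => K ^ (p - 1) * T1') (𝓝 1) (𝓝 (1 ^ (p-1) * T1')) :=
      ENNReal.Tendsto.mul_const (ENNReal.continuous_rpow_const.tendsto 1) (Or.inr hT2.ne_top)
    rw [ENNReal.one_rpow, one_mul] at hc
    have h1 := (hc.eventually (gt_mem_nhds hT2)).and (gt_mem_nhds ENNReal.one_lt_top)
    have h2 : ∃ᶠ K in 𝓝 (1:ℝ≥0∞), 1 < K := by
      rw [Filter.frequently_iff_neBot]
      have : (𝓝[>] (1:ℝ≥0∞)).NeBot := inferInstance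
      exact this
    obtain ⟨K, hK, h3, h4⟩ := (h2.and_eventually h1).exists
    exact ⟨K, hK, h4.ne, h3⟩
  obtain ⟨C, hC, hCineq⟩ := pow_ineq hp hK1 hKtop
  obtain ⟨τ, hτ0, hτ⟩ := ENNReal.exists_pos_sum_of_countable (tsub_pos_of_lt hT1).ne' ℕ
  set M : ℕ → ℝ≥0∞ := fun k => cheegerOpen m p u (W k) + τ k with hM
  have hMsum : ∑' k, M k ≤ T1 := by
    rw [hM, ENNReal.tsum_add]
    calc _ ≤ ∑' k, cheegerOpen m p u (W k) + (T1 - ∑' k, cheegerOpen m p u (W k)) := by gcongr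
      _ = T1 := add_tsub_cancel_of_le hT1.le
  have hseq : ∀ k, ∃ v : ℕ → X → ℝ, (∀ n, LocLipschitzOn (W k) (v n)) ∧
      TendstoLpLoc m p (W k) v u ∧
      Filter.liminf (fun n => ∫⁻ x in W k, lipAt (W k) (v n) x ^ p ∂m) atTop < M k := by
    intro k
    have hlt : cheegerOpen m p u (W k) < M k :=
      ENNReal.lt_add_right ((ENNReal.le_tsum k).trans_lt hT |>.ne_top)
        (by simpa using (hτ0 k).ne')
    rw [cheegerOpen] at hlt
    simp only [iInf_lt_iff] at hlt
    obtain ⟨v, h1, h2, h3⟩ := hlt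
    exact ⟨v, h1, h2, h3⟩
  choose v hvL hvT hvM using hseq
  have hNB : ∀ k, (atTop ⊓ 𝓟 {n | ∫⁻ x in W k, lipAt (W k) (v k n) x ^ p ∂m < M k}).NeBot :=
    fun k => Filter.frequently_mem_iff_neBot.1 (frequently_lt_of_liminf_lt (by isBoundedDefault) (hvM k))
  let 𝒰 : ℕ → Ultrafilter ℕ := fun k => @Ultrafilter.of _ _ (hNB k)
  have h𝒰1 : ∀ k, (𝒰 k : Filter ℕ) ≤ atTop := fun k => (Ultrafilter.of_le _).trans inf_le_left
  have h𝒰2 : ∀ k, ∀ᶠ n in (𝒰 k : Filter ℕ), ∫⁻ x in W k, lipAt (W k) (v k n) x ^ p ∂m < M k := by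
    intro k
    have : (𝒰 k : Filter ℕ) ≤ 𝓟 _ := (Ultrafilter.of_le _).trans inf_le_right
    exact this (mem_principal_self _)
  have hrad : ∀ x, ∃ k r, x ∈ U → 0 < r ∧ closedBall x r ⊆ W k ∧
      Tendsto (fun n => ∫⁻ x' in closedBall x r, ENNReal.ofReal |v k n x' - u x'| ^ p ∂m)
        atTop (𝓝 0) := by
    intro x
    by_cases hx : x ∈ U
    · obtain ⟨k, hk⟩ := mem_iUnion.1 hx
      obtain ⟨r, hr, ht⟩ := hvT k x hk
      obtain ⟨s, hs, hsU⟩ := Metric.nhds_basis_closedBall.mem_iff.1 ((hW k).mem_nhds hk)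
      have hsub : closedBall x (min r s) ⊆ W k :=
        (closedBall_subset_closedBall (min_le_right _ _)).trans hsU
      refine ⟨k, min r s, fun _ => ⟨lt_min hr hs, hsub, ?_⟩⟩
      refine tendsto_of_tendsto_of_tendsto_of_le_of_le tendsto_const_nhds ht
        (fun _ => zero_le) fun n => ?_
      exact lintegral_mono_set (subset_inter hsub (closedBall_subset_closedBall (min_le_left _ _)))
    · exact ⟨0, 0, fun h => absurd h hx⟩
  choose κ R hκR using hrad
  obtain ⟨c, ψ, L, hc, hψ0, hψ1, hψL, hψB, hψN, hψs⟩ :=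
    exists_partition hne R (fun x hx => (hκR x hx).1)
  set k : ℕ → ℕ := fun i => κ (c i) with hk
  set B : ℕ → Set X := fun i => closedBall (c i) (R (c i)) with hB
  have hBW : ∀ i, B i ⊆ W (k i) := fun i => (hκR _ (hc i)).2.1
  have hBm : ∀ i, MeasurableSet (B i) := fun i => measurableSet_closedBall
  have hWm : ∀ i, MeasurableSet (W i) := fun i => (hW i).measurableSet
  set ψ' : ℕ → X → ℝ≥0∞ := fun i x => ENNReal.ofReal (ψ i x) with hψ'
  have hψ'm : ∀ i, Measurable (ψ' i) := fun i =>
    ((hψL i).continuous.measurable).ennreal_ofReal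
  have hψ's : ∀ (s : Finset ℕ) x, ∑ i ∈ s, ψ' i x ≤ 1 := by
    intro s x
    rw [hψ', ← ENNReal.ofReal_sum_of_nonneg (fun i _ => hψ0 i x)]
    exact ENNReal.ofReal_le_one.2 (hψs s x)
  set G : ℕ → ℕ → X → ℝ≥0∞ := fun k n => (W k).indicator (lipAt (W k) (v k n)) with hG
  have hGm : ∀ k n, Measurable (G k n) := fun k n =>
    measurable_lipAt (hW k) fun x hx => ((hvL k n).continuousAt hx).continuousWithinAt
  have hGI : ∀ k n, ∫⁻ x, G k n x ^ p ∂m = ∫⁻ x in W k, lipAt (W k) (v k n) x ^ p ∂m := by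
    intro k n
    rw [← lintegral_indicator (hWm k)]
    congr 1; funext x
    by_cases hx : x ∈ W k
    · simp [hG, hx]
    · simp [hG, hx, hp0]
  set J : ℕ → ℕ → ℝ≥0∞ := fun i n => ∫⁻ x, ψ' i x * G (k i) n x ^ p ∂m with hJ
  have hlim : ∀ i, ∃ a, Tendsto (J i) (𝒰 (k i)) (𝓝 a) := by
    intro i
    obtain ⟨a, -, ha⟩ := isCompact_univ.ultrafilter_le_nhds ((𝒰 (k i)).map (J i)) (by simp)
    exact ⟨a, ha⟩
  choose a ha using hlim
  have hasum : ∑' i, a i ≤ T1 := by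
    have h1 : ∑' i, a i = ∑' i, ∑' j, if j = k i then a i else 0 := by
      congr 1; funext i; rw [tsum_ite_eq]
    rw [h1, ENNReal.tsum_comm]
    refine le_trans (ENNReal.tsum_le_tsum fun j => ?_) hMsum
    rw [ENNReal.tsum_eq_iSup_sum]
    refine iSup_le fun s => ?_
    rw [← Finset.sum_filter]
    have ht : Tendsto (fun n => ∑ i ∈ s.filter (fun i => j = k i), J i n) (𝒰 j)
        (𝓝 (∑ i ∈ s.filter (fun i => j = k i), a i)) := by
      refine tendsto_finsetSum _ fun i hi => ?_
      rw [(Finset.mem_filter.1 hi).2]; exact ha i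
    refine le_of_tendsto ht ?_
    filter_upwards [h𝒰2 j] with n hn
    refine le_trans ?_ hn.le
    rw [← hGI]
    have : ∀ i ∈ s.filter (fun i => j = k i), J i n = ∫⁻ x, ψ' i x * G j n x ^ p ∂m := by
      intro i hi
      simp only [hJ, ← (Finset.mem_filter.1 hi).2]
    have hmm : ∀ i ∈ s.filter (fun i => j = k i), Measurable fun x => ψ' i x * G j n x ^ p :=
      fun i _ => (hψ'm i).mul ((hGm j n).pow_const p)
    rw [Finset.sum_congr rfl this, ← lintegral_finsetSum _ hmm]
    refine lintegral_mono fun x => ?_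
    simp only
    rw [← Finset.sum_mul]
    exact mul_le_of_le_one_left zero_le (hψ's _ x)
  obtain ⟨δ, hδ0, hδ⟩ := ENNReal.exists_pos_sum_of_countable
    (ε := min ε (min (T1' - T1) (T - T2)))
    (lt_min hε (lt_min (tsub_pos_of_lt hT1') (tsub_pos_of_lt hT2T))).ne' ℕ
  have hδ0' : ∀ i, (0:ℝ≥0∞) < δ i := fun i => by simpa using hδ0 i
  have hδ1 : ∑' i, (δ i : ℝ≥0∞) ≤ ε := hδ.le.trans (min_le_left _ _)
  have hδ2 : ∑' i, (δ i : ℝ≥0∞) ≤ T1' - T1 :=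
    hδ.le.trans ((min_le_right _ _).trans (min_le_left _ _))
  have hδ3 : ∑' i, (δ i : ℝ≥0∞) ≤ T - T2 :=
    hδ.le.trans ((min_le_right _ _).trans (min_le_right _ _))
  have hatop : ∀ i, a i ≠ ⊤ := fun i =>
    ((ENNReal.le_tsum i).trans_lt (hasum.trans_lt hT1T)).ne_top
  have hchoose : ∀ i, ∃ n, J i n ≤ a i + δ i ∧
      ∫⁻ x' in B i, ENNReal.ofReal |v (k i) n x' - u x'| ^ p ∂m ≤ δ i ∧
      C i * (L i : ℝ≥0∞) ^ p * ∫⁻ x' in B i, ENNReal.ofReal |v (k i) n x' - u x'| ^ p ∂m ≤ δ i := by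
    intro i
    have e1 : ∀ᶠ n in (𝒰 (k i) : Filter ℕ), J i n < a i + δ i :=
      (ha i).eventually (gt_mem_nhds (ENNReal.lt_add_right (hatop i) (hδ0' i).ne'))
    have ht := (hκR _ (hc i)).2.2.mono_left (h𝒰1 (k i))
    have e2 := ht.eventually (gt_mem_nhds (hδ0' i))
    have hct : C i * (L i : ℝ≥0∞) ^ p ≠ ⊤ := ENNReal.mul_ne_top (hC i)
      (ENNReal.rpow_ne_top_of_nonneg hp0.le ENNReal.coe_ne_top)
    have ht' := ENNReal.Tendsto.const_mul ht (Or.inr hct)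
    rw [mul_zero] at ht'
    have e3 := ht'.eventually (gt_mem_nhds (hδ0' i))
    obtain ⟨n, h1, h2, h3⟩ := (e1.and (e2.and e3)).exists
    exact ⟨n, h1.le, h2.le, h3.le⟩
  choose n hn1 hn2 hn3 using hchoose
  set z : ℕ → X → ℝ := fun i => v (k i) (n i) with hz
  have hzL : ∀ i, LocLipschitzOn (W (k i)) (z i) := fun i => hvL _ _
  set g : ℕ → X → ℝ≥0∞ := fun i => G (k i) (n i) with hg
  have hgm : ∀ i, Measurable (g i) := fun i => hGm _ _
  set d : ℕ → X → ℝ≥0∞ := fun i => (B i).indicator (fun x => ENNReal.ofReal |z i x - u x|) with hd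
  have hdm : ∀ i, Measurable (d i) := by
    intro i
    classical
    have h1 : Measurable ((B i).piecewise (z i) (fun _ => 0)) :=
      ContinuousOn.measurable_piecewise
        (fun x hx => ((hzL i).continuousAt (hBW i hx)).continuousWithinAt)
        continuousOn_const (hBm i)
    have h2 : d i = (B i).indicator
        (fun x => ENNReal.ofReal |(B i).piecewise (z i) (fun _ => 0) x - u x|) := by
      rw [hd]
      refine indicator_congr fun x hx => ?_
      rw [piecewise_eq_of_mem _ _ _ hx]
    rw [h2]
    refine Measurable.indicator ?_ (hBm i)
    have h3 := (h1.sub hu).norm.ennreal_ofReal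
    exact h3
  have hdI : ∀ i, ∫⁻ x, d i x ^ p ∂m = ∫⁻ x' in B i, ENNReal.ofReal |z i x' - u x'| ^ p ∂m := by
    intro i
    rw [← lintegral_indicator (hBm i)]
    congr 1; funext x
    by_cases hx : x ∈ B i
    · simp [hd, hx]
    · simp [hd, hx, hp0]
  set w : X → ℝ := fun x => ∑' i, ψ i x * z i x with hw
  have hwloc : ∀ x ∈ U, ∃ N : ℕ, ∀ᶠ y in 𝓝 x, ∑ i ∈ Finset.range N, ψ i y = 1 ∧
      w y = ∑ i ∈ Finset.range N, ψ i y * z i y := by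
    intro x hx
    obtain ⟨N, hN⟩ := hψN x hx
    refine ⟨N, ?_⟩
    filter_upwards [hN] with y hy
    refine ⟨hy.2, ?_⟩
    rw [hw]
    exact tsum_eq_sum fun i hi => by
      rw [hy.1 i (by simpa using hi), zero_mul]
  have hψev : ∀ i x, x ∉ B i → ψ i =ᶠ[𝓝 x] fun _ => 0 := by
    intro i x hx
    filter_upwards [isClosed_closedBall.isOpen_compl.mem_nhds hx] with y hy
    exact hψB i y hy
  refine ⟨w, ?_, ?_, ?_⟩
  · -- locally Lipschitz
    intro x hx
    obtain ⟨N, hN⟩ := hwloc x hx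
    have hLL : LL x w := by
      refine (LL.sum (h := fun i y => ψ i y * z i y) (Finset.range N) fun i _ => ?_).congr
        (hN.mono fun y hy => hy.2)
      by_cases hxi : x ∈ B i
      · obtain ⟨r, hr, K, -, hK⟩ := hzL i x (hBW i hxi)
        exact LL.mul ⟨r, hr, K, hK⟩ (hψL i) (hψ0 i) (hψ1 i)
      · refine LL.congr (h := fun _ => 0) ⟨1, one_pos, 0,
          (LipschitzWith.const (0:ℝ)).lipschitzOnWith⟩ ?_
        filter_upwards [hψev i x hxi] with y hy
        rw [hy, zero_mul]
    obtain ⟨r, hr, K, hK⟩ := hLL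
    obtain ⟨s, hs, hsU⟩ := Metric.nhds_basis_closedBall.mem_iff.1 (hU.mem_nhds hx)
    exact ⟨min r s, lt_min hr hs, K, (closedBall_subset_closedBall (min_le_right _ _)).trans hsU,
      hK.mono (closedBall_subset_closedBall (min_le_left _ _))⟩
  · -- L^p closeness
    calc ∫⁻ x in U, ENNReal.ofReal |w x - u x| ^ p ∂m ≤ ∫⁻ x in U, ∑' i, d i x ^ p ∂m := by
          refine setLIntegral_mono' hU.measurableSet fun x hx => ?_
          obtain ⟨N, hN⟩ := hwloc x hx
          obtain ⟨h1, h2⟩ := hN.self_of_nhds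
          have e1 : w x - u x = ∑ i ∈ Finset.range N, ψ i x * (z i x - u x) := by
            simp only [mul_sub, Finset.sum_sub_distrib, ← Finset.sum_mul, h1, one_mul, h2]
          have e2 : ENNReal.ofReal |w x - u x| ≤ ∑ i ∈ Finset.range N, ψ' i x * d i x := by
            rw [e1]
            calc _ ≤ ENNReal.ofReal (∑ i ∈ Finset.range N, |ψ i x * (z i x - u x)|) :=
                  ENNReal.ofReal_le_ofReal (Finset.abs_sum_le_sum_abs _ _)
              _ = ∑ i ∈ Finset.range N, ENNReal.ofReal |ψ i x * (z i x - u x)| :=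
                  ENNReal.ofReal_sum_of_nonneg fun i _ => abs_nonneg _
              _ ≤ _ := by
                  refine Finset.sum_le_sum fun i _ => ?_
                  by_cases hxi : x ∈ B i
                  · rw [abs_mul, abs_of_nonneg (hψ0 i x), ENNReal.ofReal_mul (hψ0 i x)]
                    simp [hd, hψ', hxi]
                  · rw [hψB i x hxi]; simp
          calc _ ≤ (∑ i ∈ Finset.range N, ψ' i x * d i x) ^ p :=
                ENNReal.rpow_le_rpow e2 hp0.le
            _ ≤ ∑ i ∈ Finset.range N, ψ' i x * d i x ^ p :=
                sub_jensen hp _ (fun i => ψ' i x) (fun i => d i x) (hψ's _ x)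
            _ ≤ ∑ i ∈ Finset.range N, d i x ^ p := by
                refine Finset.sum_le_sum fun i _ => mul_le_of_le_one_left zero_le ?_
                exact ENNReal.ofReal_le_one.2 (hψ1 i x)
            _ ≤ _ := ENNReal.sum_le_tsum _
      _ ≤ ∫⁻ x, ∑' i, d i x ^ p ∂m := setLIntegral_le_lintegral _ _
      _ = ∑' i, ∫⁻ x, d i x ^ p ∂m := lintegral_tsum fun i => ((hdm i).pow_const p).aemeasurable
      _ ≤ ∑' i, (δ i : ℝ≥0∞) := ENNReal.tsum_le_tsum fun i => by rw [hdI]; exact hn2 i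
      _ ≤ ε := hδ1
  · -- energy bound
    have hpt : ∀ x ∈ U, lipAt U w x ^ p ≤ K ^ (p - 1) * ∑' i, ψ' i x * g i x ^ p +
        ∑' i, C i * ((L i : ℝ≥0∞) * d i x) ^ p := by
      intro x hx
      obtain ⟨N, hN⟩ := hwloc x hx
      classical
      set t : ℕ → ℝ := fun i => if x ∈ B i then
        ψ i x * (lipAt (W (k i)) (z i) x).toReal + L i * |z i x - u x| else 0 with ht
      have ht0 : ∀ i, 0 ≤ t i := by
        intro i
        simp only [ht]
        split_ifs
        · have := hψ0 i x
          positivity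
        · exact le_rfl
      have hLB : LipB w x (∑ i ∈ Finset.range N, t i) := by
        have h1 : LipB (fun y => ∑ i ∈ Finset.range N, ψ i y * (z i y - u x)) x
            (∑ i ∈ Finset.range N, t i) := by
          refine LipB.sum (v := fun i y => ψ i y * (z i y - u x)) _ fun i _ => ?_
          by_cases hxi : x ∈ B i
          · have hxW := hBW i hxi
            simp only [ht, if_pos hxi]
            exact LipB.mul (lipB_of_lipAt ((hW _).mem_nhds hxW)
              ((hzL i).lipAt_ne_top hxW (hW _))) (hψL i) (hψ0 i x) (u x)
              ((hzL i).continuousAt hxW)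
          · simp only [ht, if_neg hxi]
            refine (LipB.zero x).congr ?_
            filter_upwards [hψev i x hxi] with y hy
            rw [hy, zero_mul]
        refine (h1.add_const (u x)).congr ?_
        filter_upwards [hN] with y hy
        simp only [mul_sub, Finset.sum_sub_distrib, ← Finset.sum_mul, hy.1, one_mul, hy.2]
        ring
      have h2 : lipAt U w x ≤ ∑ i ∈ Finset.range N, (ψ' i x * g i x + (L i : ℝ≥0∞) * d i x) := by
        refine (hLB.lipAt_le (hU.mem_nhds hx) (Finset.sum_nonneg fun i _ => ht0 i)).trans ?_
        rw [ENNReal.ofReal_sum_of_nonneg fun i _ => ht0 i]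
        refine Finset.sum_le_sum fun i _ => ?_
        by_cases hxi : x ∈ B i
        · have hxW := hBW i hxi
          simp only [ht, if_pos hxi]
          refine ENNReal.ofReal_add_le.trans ?_
          rw [ENNReal.ofReal_mul (hψ0 i x), ENNReal.ofReal_mul (NNReal.coe_nonneg (L i)),
            ENNReal.ofReal_toReal ((hzL i).lipAt_ne_top hxW (hW _))]
          simp [hd, hψ', hxi, hg, hG, hxW, hz]
        · simp [ht, hxi]
      calc _ ≤ (∑ i ∈ Finset.range N, (ψ' i x * g i x + (L i : ℝ≥0∞) * d i x)) ^ p :=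
            ENNReal.rpow_le_rpow h2 hp0.le
        _ ≤ _ := hCineq _ (fun i => ψ' i x) (fun i => g i x) (fun i => (L i : ℝ≥0∞) * d i x)
            (hψ's _ x)
        _ ≤ _ := by
            gcongr
            · exact ENNReal.sum_le_tsum _
            · exact ENNReal.sum_le_tsum _
    have hm1 : ∀ i, Measurable fun x => ψ' i x * g i x ^ p :=
      fun i => (hψ'm i).mul ((hgm i).pow_const p)
    have hm2 : ∀ i, Measurable fun x => C i * ((L i : ℝ≥0∞) * d i x) ^ p :=
      fun i => (((hdm i).const_mul _).pow_const p).const_mul _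
    have hI1 : ∑' i, ∫⁻ x, ψ' i x * g i x ^ p ∂m ≤ T1' := by
      calc _ ≤ ∑' i, (a i + δ i) := ENNReal.tsum_le_tsum fun i => hn1 i
        _ = ∑' i, a i + ∑' i, (δ i : ℝ≥0∞) := ENNReal.tsum_add
        _ ≤ T1 + (T1' - T1) := add_le_add hasum hδ2
        _ = T1' := add_tsub_cancel_of_le hT1'.le
    have hI2 : ∑' i, ∫⁻ x, C i * ((L i : ℝ≥0∞) * d i x) ^ p ∂m ≤ T - T2 := by
      refine le_trans (ENNReal.tsum_le_tsum fun i => ?_) hδ3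
      simp only [ENNReal.mul_rpow_of_nonneg _ _ hp0.le, ← mul_assoc]
      rw [lintegral_const_mul _ ((hdm i).pow_const p), hdI]
      exact hn3 i
    calc ∫⁻ x in U, lipAt U w x ^ p ∂m
        ≤ ∫⁻ x in U, (K ^ (p - 1) * ∑' i, ψ' i x * g i x ^ p +
            ∑' i, C i * ((L i : ℝ≥0∞) * d i x) ^ p) ∂m :=
          setLIntegral_mono' hU.measurableSet hpt
      _ ≤ ∫⁻ x, (K ^ (p - 1) * ∑' i, ψ' i x * g i x ^ p +
            ∑' i, C i * ((L i : ℝ≥0∞) * d i x) ^ p) ∂m := setLIntegral_le_lintegral _ _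
      _ = K ^ (p - 1) * ∑' i, ∫⁻ x, ψ' i x * g i x ^ p ∂m +
            ∑' i, ∫⁻ x, C i * ((L i : ℝ≥0∞) * d i x) ^ p ∂m := by
          rw [lintegral_add_left ((Measurable.ennreal_tsum hm1).const_mul _),
            lintegral_const_mul _ (Measurable.ennreal_tsum hm1),
            lintegral_tsum fun i => (hm1 i).aemeasurable,
            lintegral_tsum fun i => (hm2 i).aemeasurable]
      _ ≤ K ^ (p - 1) * T1' + (T - T2) := by gcongr
      _ ≤ T2 + (T - T2) := by gcongr
      _ = T := add_tsub_cancel_of_le hT2T.le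

lemma cheegerOpen_iUnion_le [BorelSpace X] [TopologicalSpace.SeparableSpace X]
    (m : Measure X) {p : ℝ} (hp : 1 ≤ p) {u : X → ℝ} (hu : Measurable u)
    (W : ℕ → Set X) (hW : ∀ k, IsOpen (W k)) :
    cheegerOpen m p u (⋃ k, W k) ≤ ∑' k, cheegerOpen m p u (W k) := by
  rcases (⋃ k, W k).eq_empty_or_nonempty with he | hne
  · rw [he]
    refine le_trans ?_ zero_le
    refine iInf_le_of_le (fun _ _ => 0) <| iInf_le_of_le (fun n x hx => absurd hx (by simp)) <|
      iInf_le_of_le (fun x hx => absurd hx (by simp)) ?_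
    simp
  refine le_of_forall_gt_imp_ge_of_dense fun T hT => ?_
  have hpos : ∀ n : ℕ, (0:ℝ≥0∞) < ((n:ℝ≥0∞) + 1)⁻¹ := fun n => by
    rw [ENNReal.inv_pos]; exact ENNReal.add_ne_top.2 ⟨by simp, by simp⟩
  choose w h1 h2 h3 using fun n : ℕ => exists_approx m hp hu W hW hne hT (hpos n)
  refine iInf_le_of_le w <| iInf_le_of_le h1 <| iInf_le_of_le ?_ ?_
  · intro x hx
    refine ⟨1, one_pos, ?_⟩
    have ht : Tendsto (fun n : ℕ => ((n:ℝ≥0∞) + 1)⁻¹) atTop (𝓝 0) := by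
      have := (tendsto_add_atTop_iff_nat 1).2 ENNReal.tendsto_inv_nat_nhds_zero
      simpa using this
    refine tendsto_of_tendsto_of_tendsto_of_le_of_le tendsto_const_nhds ht
        (fun _ => zero_le) fun n => ?_
    exact (lintegral_mono_set inter_subset_left).trans (h2 n)
  · refine (liminf_le_liminf (Eventually.of_forall h3)).trans ?_
    simp


lemma exists_om [BorelSpace X] (F : Set X → ℝ≥0∞) (h0 : F ∅ = 0)
    (hmono : ∀ U V, IsOpen U → IsOpen V → U ⊆ V → F U ≤ F V)
    (hsub : ∀ U : ℕ → Set X, (∀ k, IsOpen (U k)) → F (⋃ k, U k) ≤ ∑' k, F (U k))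
    (hsup : ∀ U V, IsOpen U → IsOpen V → Disjoint U V → F U + F V ≤ F (U ∪ V)) :
    ∃ ν' : OuterMeasure X, IsBorelRegularOM ν' ∧
      ∀ S, ν' S = ⨅ (U : Set X) (_ : IsOpen U) (_ : S ⊆ U), F U := by
  have PU : ∀ ⦃f : ℕ → Set X⦄, (∀ i, IsOpen (f i)) → IsOpen (⋃ i, f i) := fun f hf => isOpen_iUnion hf
  let ν' : OuterMeasure X := inducedOuterMeasure (P := IsOpen) (fun U _ => F U) isOpen_empty h0
  have hmono' : ∀ ⦃s t : Set X⦄ (hs : IsOpen s) (ht : IsOpen t), s ⊆ t → F s ≤ F t :=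
    fun s t hs ht => hmono s t hs ht
  have hinf : ∀ S, ν' S = ⨅ (U : Set X) (_ : IsOpen U) (_ : S ⊆ U), F U :=
    fun S => inducedOuterMeasure_eq_iInf PU hsub hmono' S
  refine ⟨ν', ⟨?_, ?_⟩, hinf⟩
  · have hM : ν'.IsMetric := by
      rintro s t ⟨r, hr, hst⟩
      refine le_antisymm (measure_union_le _ _) ?_
      obtain ⟨U, V, hU, hV, hsU, htV, hUV⟩ : ∃ U V : Set X, IsOpen U ∧ IsOpen V ∧ s ⊆ U ∧ t ⊆ V ∧
          Disjoint U V := by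
        refine ⟨⋃ x ∈ s, Metric.eball x (r / 2), ⋃ y ∈ t, Metric.eball y (r / 2),
          isOpen_biUnion fun _ _ => Metric.isOpen_eball,
          isOpen_biUnion fun _ _ => Metric.isOpen_eball, ?_, ?_, ?_⟩
        · intro x hx
          exact mem_biUnion hx (Metric.mem_eball_self (ENNReal.half_pos hr))
        · intro x hx
          exact mem_biUnion hx (Metric.mem_eball_self (ENNReal.half_pos hr))
        · rw [Set.disjoint_left]
          intro z hz hz'
          simp only [mem_iUnion, exists_prop, Metric.mem_eball] at hz hz'
          obtain ⟨x, hx, hzx⟩ := hz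
          obtain ⟨y, hy, hzy⟩ := hz'
          have h1 : edist x y < r := by
            calc edist x y ≤ edist x z + edist z y := edist_triangle _ _ _
              _ < r / 2 + r / 2 := by
                rw [edist_comm x z]; exact ENNReal.add_lt_add hzx hzy
              _ = r := ENNReal.add_halves r
          exact absurd (hst x hx y hy) (not_le.2 h1)
      rw [hinf (s ∪ t)]
      refine le_iInf fun W => le_iInf fun hW => le_iInf fun hst => ?_
      have h1 : ν' s ≤ F (W ∩ U) := by
        rw [hinf]
        exact iInf_le_of_le (W ∩ U) <| iInf_le_of_le (hW.inter hU) <|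
          iInf_le_of_le (subset_inter (subset_union_left.trans hst) hsU) le_rfl
      have h2 : ν' t ≤ F (W ∩ V) := by
        rw [hinf]
        exact iInf_le_of_le (W ∩ V) <| iInf_le_of_le (hW.inter hV) <|
          iInf_le_of_le (subset_inter (subset_union_right.trans hst) htV) le_rfl
      refine (add_le_add h1 h2).trans <| (hsup _ _ (hW.inter hU) (hW.inter hV)
        (hUV.mono inter_subset_right inter_subset_right)).trans ?_
      exact hmono _ _ ((hW.inter hU).union (hW.inter hV)) hW
        (union_subset inter_subset_left inter_subset_left)
    intro B hB
    have := hM.borel_le_caratheodory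
    rw [← BorelSpace.measurable_eq (α := X)] at this
    exact this B hB
  · intro S
    by_cases hS : ν' S = ⊤
    · exact ⟨univ, MeasurableSet.univ, subset_univ _, by
        rw [hS]; exact (top_le_iff.1 (hS ▸ measure_mono (subset_univ S))).symm⟩
    have hpos : ∀ n : ℕ, ((n:ℝ≥0∞) + 1)⁻¹ ≠ 0 := fun n => by
      rw [Ne, ENNReal.inv_eq_zero]; exact ENNReal.add_ne_top.2 ⟨by simp, by simp⟩
    choose t ht1 ht2 ht3 using fun n : ℕ =>
      inducedOuterMeasure_exists_set PU hsub hmono' hS (hpos n)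
    refine ⟨⋂ n, t n, MeasurableSet.iInter fun n => (ht1 n).measurableSet,
      subset_iInter ht2, le_antisymm (measure_mono (subset_iInter ht2)) ?_⟩
    have ht : Tendsto (fun n : ℕ => ν' S + ((n:ℝ≥0∞) + 1)⁻¹) atTop (𝓝 (ν' S + 0)) := by
      have := (tendsto_add_atTop_iff_nat 1).2 ENNReal.tendsto_inv_nat_nhds_zero
      refine Tendsto.const_add _ ?_
      simpa using this
    rw [add_zero] at ht
    exact ge_of_tendsto' ht fun n => (measure_mono (iInter_subset _ n)).trans (ht3 n)

def IsFam {Y : Type*} [MetricSpace Y] (U : Set X) (q : (ℕ → Set X) × (ℕ → Y → ℝ)) : Prop :=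
  (∀ j, IsOpen (q.1 j) ∧ q.1 j ⊆ U) ∧ Pairwise (Function.onFun Disjoint q.1) ∧
        ∀ j, BddLip1 (q.2 j)

def famSup (m : Measure X) (p : ℝ) {Y : Type*} [MetricSpace Y] (f : X → Y) (U : Set X) : ℝ≥0∞ :=
  ⨆ c : {q : (ℕ → Set X) × (ℕ → Y → ℝ) // IsFam U q},
    ∑' j : ℕ, cheegerOpen m p (c.1.2 j ∘ f) (c.1.1 j)

lemma cheegerOpen_empty (m : Measure X) (p : ℝ) (u : X → ℝ) : cheegerOpen m p u ∅ = 0 := by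
  refine le_antisymm ?_ zero_le
  refine iInf_le_of_le (fun _ _ => 0) <| iInf_le_of_le (fun n x hx => absurd hx (by simp)) <|
    iInf_le_of_le (fun x hx => absurd hx (by simp)) ?_
  simp

lemma bddLip1_zero {Y : Type*} [MetricSpace Y] : BddLip1 (fun _ : Y => (0:ℝ)) :=
  ⟨⟨0, by simp⟩, LipschitzWith.const' 0⟩

section
variable {Y : Type*} [MetricSpace Y]

lemma famSup_empty (m : Measure X) (p : ℝ) (f : X → Y) : famSup m p f ∅ = 0 := by
  refine le_antisymm (iSup_le ?_) zero_le
  rintro ⟨⟨O, φ⟩, h1, h2, h3⟩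
  have : ∀ j, O j = ∅ := fun j => subset_empty_iff.1 (h1 j).2
  simp [this, cheegerOpen_empty]

lemma famSup_mono (m : Measure X) (p : ℝ) (f : X → Y) {U V : Set X} (h : U ⊆ V) :
    famSup m p f U ≤ famSup m p f V := by
  refine iSup_le ?_
  rintro ⟨⟨O, φ⟩, h1, h2, h3⟩
  exact le_iSup (fun c : {q : (ℕ → Set X) × (ℕ → Y → ℝ) // IsFam V q} =>
    ∑' j : ℕ, cheegerOpen m p (c.1.2 j ∘ f) (c.1.1 j))
    ⟨(O, φ), fun j => ⟨(h1 j).1, (h1 j).2.trans h⟩, h2, h3⟩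

lemma famSup_sub [BorelSpace X] [TopologicalSpace.SeparableSpace X] (m : Measure X) {p : ℝ}
    (hp : 1 ≤ p) {Ω : Set X} (hΩ : IsOpen Ω) (f : X → Y) (hf : MemB m Ω f)
    (U : ℕ → Set X) (hU : ∀ k, IsOpen (U k)) (hUΩ : ∀ k, U k ⊆ Ω) :
    famSup m p f (⋃ k, U k) ≤ ∑' k, famSup m p f (U k) := by
  refine iSup_le ?_
  rintro ⟨⟨O, φ⟩, h1, h2, h3⟩
  simp only at h1 h2 h3 ⊢
  have key : ∀ j, cheegerOpen m p (φ j ∘ f) (O j) ≤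
      ∑' k, cheegerOpen m p (φ j ∘ f) (O j ∩ U k) := by
    intro j
    have hO : O j = ⋃ k, O j ∩ U k := by
      rw [← inter_iUnion, inter_eq_left.2 (h1 j).2]
    have hm : Measurable (Ω.indicator (φ j ∘ f)) := by
      letI : MeasurableSpace Y := borel Y
      haveI : BorelSpace Y := ⟨rfl⟩
      have h4 : Measurable fun x : Ω => f x := hf.1
      have h5 : Measurable (φ j) := (h3 j).2.continuous.measurable
      refine measurable_of_restrict_of_restrict_compl hΩ.measurableSet ?_ ?_
      · have : Ω.domRestrict (Ω.indicator (φ j ∘ f)) = φ j ∘ fun x : Ω => f x := by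
          ext x; simp
        rw [this]
        exact h5.comp h4
      · have : Ωᶜ.domRestrict (Ω.indicator (φ j ∘ f)) = fun _ => 0 := by
          ext x; simpa using fun h => absurd h x.2
        rw [this]
        exact measurable_const
    have hOΩ : O j ⊆ Ω := (h1 j).2.trans (iUnion_subset hUΩ)
    have heq : ∀ A, A ⊆ Ω → IsOpen A → cheegerOpen m p (φ j ∘ f) A =
        cheegerOpen m p (Ω.indicator (φ j ∘ f)) A := fun A hA hAo =>
      cheegerOpen_congr m p hAo fun x hx => by simp [hA hx]
    rw [heq _ hOΩ (h1 j).1]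
    conv_lhs => rw [hO]
    refine (cheegerOpen_iUnion_le m hp hm (fun k => O j ∩ U k) fun k => (h1 j).1.inter (hU k)).trans ?_
    refine ENNReal.tsum_le_tsum fun k => (heq _ (inter_subset_left.trans hOΩ)
      ((h1 j).1.inter (hU k))).ge
  refine (ENNReal.tsum_le_tsum key).trans ?_
  rw [ENNReal.tsum_comm]
  refine ENNReal.tsum_le_tsum fun k => ?_
  exact le_iSup (fun c : {q : (ℕ → Set X) × (ℕ → Y → ℝ) // IsFam (U k) q} =>
    ∑' j : ℕ, cheegerOpen m p (c.1.2 j ∘ f) (c.1.1 j))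
    ⟨(fun j => O j ∩ U k, φ), fun j => ⟨(h1 j).1.inter (hU k), inter_subset_right⟩,
      fun i j hij => (h2 hij).mono inter_subset_left inter_subset_left, h3⟩

lemma famSup_sup (m : Measure X) (p : ℝ) (f : X → Y) {U V : Set X} (h : Disjoint U V) :
    famSup m p f U + famSup m p f V ≤ famSup m p f (U ∪ V) := by
  have hne : ∀ W : Set X, Nonempty {q : (ℕ → Set X) × (ℕ → Y → ℝ) // IsFam W q} := fun W =>
    ⟨⟨(fun _ => ∅, fun _ _ => 0), by simp, fun _ _ _ => by simp [Function.onFun],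
      fun _ => bddLip1_zero⟩⟩
  haveI := hne U
  haveI := hne V
  refine ENNReal.iSup_add_iSup_le ?_
  rintro ⟨⟨O, φ⟩, h1, h2, h3⟩ ⟨⟨O', φ'⟩, h1', h2', h3'⟩
  simp only at h1 h2 h3 h1' h2' h3' ⊢
  let e := Equiv.natSumNatEquivNat
  refine le_trans ?_ (le_iSup (fun c : {q : (ℕ → Set X) × (ℕ → Y → ℝ) // IsFam (U ∪ V) q} =>
    ∑' j : ℕ, cheegerOpen m p (c.1.2 j ∘ f) (c.1.1 j))
    ⟨(fun j => Sum.elim O O' (e.symm j), fun j => Sum.elim φ φ' (e.symm j)), ?_, ?_, ?_⟩)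
  · rw [← e.tsum_eq (fun j => cheegerOpen m p (Sum.elim φ φ' (e.symm j) ∘ f)
      (Sum.elim O O' (e.symm j)))]
    simp only [Equiv.symm_apply_apply]
    rw [ENNReal.summable.tsum_sum ENNReal.summable]
    simp
  · intro j
    simp only
    rcases e.symm j with i | i
    · exact ⟨(h1 i).1, (h1 i).2.trans subset_union_left⟩
    · exact ⟨(h1' i).1, (h1' i).2.trans subset_union_right⟩
  · intro i j hij
    have hij' : e.symm i ≠ e.symm j := fun h => hij (e.symm.injective h)
    simp only [Function.onFun]
    revert hij'
    rcases e.symm i with a | a <;> rcases e.symm j with b | b <;> intro hij'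
    · exact h2 fun h => hij' (by rw [h])
    · exact h.mono (h1 a).2 (h1' b).2
    · exact h.symm.mono (h1' a).2 (h1 b).2
    · exact h2' fun h => hij' (by rw [h])
  · intro j
    simp only
    rcases e.symm j with i | i
    · exact h3 i
    · exact h3' i

lemma le_famSup (m : Measure X) (p : ℝ) (f : X → Y) {U : Set X} (hU : IsOpen U) {φ : Y → ℝ}
    (hφ : BddLip1 φ) : cheegerOpen m p (φ ∘ f) U ≤ famSup m p f U := by
  refine le_trans ?_ (le_iSup (fun c : {q : (ℕ → Set X) × (ℕ → Y → ℝ) // IsFam U q} =>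
    ∑' j : ℕ, cheegerOpen m p (c.1.2 j ∘ f) (c.1.1 j))
    ⟨(fun j => if j = 0 then U else ∅, fun _ => φ), ?_, ?_, fun _ => hφ⟩)
  · refine le_trans ?_ (ENNReal.le_tsum 0)
    simp
  · intro j
    by_cases hj : j = 0 <;> simp [hj, hU]
  · intro i j hij
    by_cases hi : i = 0
    · have : j ≠ 0 := fun h => hij (by rw [hi, h])
      simp [Function.onFun, this]
    · simp [Function.onFun, hi]

end

lemma isOpen_coe_image (hloc : ∀ x : X, ∃ r > 0, IsComplete (closedBall x r)) {Ω : Set X}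
    (hΩ : IsOpen Ω) : IsOpen ((fun a : X => (a : UniformSpace.Completion X)) '' Ω) := by
  rw [Metric.isOpen_iff]
  rintro _ ⟨x, hx, rfl⟩
  obtain ⟨r, hr, hc⟩ := hloc x
  obtain ⟨t, ht, htΩ⟩ := Metric.nhds_basis_closedBall.mem_iff.1 (hΩ.mem_nhds hx)
  have hs : 0 < min r t := lt_min hr ht
  have hc' : IsComplete (closedBall x (min r t)) :=
    fun l hl hls => by
      obtain ⟨y, -, hy⟩ := hc l hl (hls.trans
        (principal_mono.2 (closedBall_subset_closedBall (min_le_left _ _))))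
      have := hl.1
      exact ⟨y, isClosed_closedBall.mem_of_tendsto (f := id) (b := l) hy (le_principal_iff.1 hls), hy⟩
  have hi : IsUniformInducing (fun a : X => (a : UniformSpace.Completion X)) :=
    UniformSpace.Completion.isUniformInducing_coe X
  have hcl : IsClosed ((fun a : X => (a : UniformSpace.Completion X)) '' closedBall x (min r t)) :=
    ((isComplete_image_iff hi).2 hc').isClosed
  refine ⟨min r t, hs, fun z hz => ?_⟩
  have : z ∈ closure ((fun a : X => (a : UniformSpace.Completion X)) '' closedBall x (min r t)) := by
    rw [_root_.mem_closure_iff]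
    intro o ho hzo
    obtain ⟨y, hy⟩ := (UniformSpace.Completion.denseRange_coe (α := X)).exists_mem_open
      (ho.inter isOpen_ball) ⟨z, hzo, hz⟩
    refine ⟨y, hy.1, y, ?_, rfl⟩
    have := hy.2
    rw [Metric.mem_ball, UniformSpace.Completion.dist_eq] at this
    exact this.le
  rw [hcl.closure_eq] at this
  exact image_mono ((closedBall_subset_closedBall (min_le_right _ _)).trans htΩ) this

lemma exhaust (hloc : ∀ x : X, ∃ r > 0, IsComplete (closedBall x r)) {Ω : Set X}
    (hΩ : IsOpen Ω) : ∃ D : ℕ → Set X, (∀ n, IsOpen (D n)) ∧ Monotone D ∧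
      (∀ n, WellInside (D n) Ω) ∧ ⋃ n, D n = Ω := by
  set C : Set (UniformSpace.Completion X) :=
    ((fun a : X => (a : UniformSpace.Completion X)) '' Ω)ᶜ with hC
  have hCc : IsClosed C := (isOpen_coe_image hloc hΩ).isClosed_compl
  have hsub : ∀ x : X, x ∉ Ω → (x : UniformSpace.Completion X) ∈ C := by
    rintro x hx ⟨y, hy, hxy⟩
    exact hx (UniformSpace.Completion.coe_injective X hxy ▸ hy)
  have hin : ∀ x : X, x ∈ Ω → (x : UniformSpace.Completion X) ∉ C := fun x hx h => h ⟨x, hx, rfl⟩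
  refine ⟨fun n => {x | ((n:ℝ≥0∞) + 1)⁻¹ < Metric.infEDist (x : UniformSpace.Completion X) C},
    fun n => ?_, ?_, fun n => ⟨?_, ?_⟩, ?_⟩
  · exact isOpen_lt continuous_const
      (Metric.continuous_infEDist.comp (UniformSpace.Completion.continuous_coe X))
  · intro a b hab x hx
    simp only [mem_ofPred_eq] at hx ⊢
    refine lt_of_le_of_lt ?_ hx
    gcongr
  · intro x hx
    by_contra h
    have : Metric.infEDist (x : UniformSpace.Completion X) C = 0 :=
      Metric.infEDist_zero_of_mem (hsub x h)
    simp [this] at hx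
  · have hpos : (0:ℝ≥0∞) < ((n:ℝ≥0∞) + 1)⁻¹ := by
      rw [ENNReal.inv_pos]; exact ENNReal.add_ne_top.2 ⟨by simp, by simp⟩
    refine hpos.trans_le ?_
    refine le_iInf fun x => le_iInf fun hx => le_iInf fun z => le_iInf fun hz => ?_
    exact (le_of_lt hx).trans (Metric.infEDist_le_edist_of_mem hz)
  · ext x
    simp only [mem_iUnion, mem_ofPred_eq]
    constructor
    · rintro ⟨n, hn⟩
      by_contra h
      have : Metric.infEDist (x : UniformSpace.Completion X) C = 0 :=
        Metric.infEDist_zero_of_mem (hsub x h)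
      simp [this] at hn
    · intro hx
      have h1 : Metric.infEDist (x : UniformSpace.Completion X) C ≠ 0 := fun h =>
        hin x hx ((Metric.mem_iff_infEDist_zero_of_closed hCc).2 h)
      obtain ⟨n, hn⟩ := ENNReal.exists_inv_nat_lt h1
      refine ⟨n, lt_of_le_of_lt ?_ hn⟩
      gcongr
      exact le_self_add

theorem statement13
    {X : Type*} [MetricSpace X] [TopologicalSpace.SeparableSpace X] [ConnectedSpace X]
    [Nontrivial X] [MeasurableSpace X] [BorelSpace X]
    (hloc : ∀ x : X, ∃ r > 0, IsComplete (closedBall x r))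
    (m : Measure X) [IsLocallyFiniteMeasure m] (hm : m ≠ 0)
    (p : ℝ) (hp : 1 ≤ p)
    (Ω : Set X) (hΩ : IsOpen Ω)
    (Y : Type*) [MetricSpace Y] (f : X → Y) (hf : MemB m Ω f)
    (ν : OuterMeasure X) (hν : IsCheegerEnergy m p Ω f ν) :
    ν Ω = (⨆ (Ω' : Set X) (_ : IsOpen Ω') (_ : WellInside Ω' Ω), ν Ω') ∧
    ν Ω = ⨆ (c : {q : (ℕ → Set X) × (ℕ → Y → ℝ) //
        (∀ j, IsOpen (q.1 j) ∧ q.1 j ⊆ Ω) ∧ Pairwise (Function.onFun Disjoint q.1) ∧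
        ∀ j, BddLip1 (q.2 j)}),
      ∑' j : ℕ, cheegerSet m p Ω (c.1.2 j ∘ f) (c.1.1 j) := by
  have hcar : ∀ B : Set X, MeasurableSet B → MeasurableSet[ν.caratheodory] B := hν.1.1
  constructor
  · refine le_antisymm ?_ ?_
    · obtain ⟨D, hD1, hD2, hD3, hD4⟩ := exhaust hloc hΩ
      have h1 : ν.toMeasure hcar (⋃ n, D n) = ⨆ n, ν.toMeasure hcar (D n) := hD2.measure_iUnion
      rw [hD4, toMeasure_apply _ _ hΩ.measurableSet] at h1
      rw [h1]
      refine iSup_le fun n => ?_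
      rw [toMeasure_apply _ _ (hD1 n).measurableSet]
      exact le_iSup_of_le (D n) <| le_iSup_of_le (hD1 n) <| le_iSup_of_le (hD3 n) le_rfl
    · exact iSup_le fun V => iSup_le fun _ => iSup_le fun hV => measure_mono hV.1
  · refine le_antisymm ?_ ?_
    · obtain ⟨ν', hreg, hν'⟩ := exists_om (fun U => famSup m p f (U ∩ Ω))
        (by simp only [empty_inter]; exact famSup_empty m p f)
        (fun U V _ _ h => famSup_mono m p f (inter_subset_inter_left _ h))
        (fun U hU => by
          simp only [iUnion_inter]
          exact famSup_sub m hp hΩ f hf _ (fun k => (hU k).inter hΩ) fun k => inter_subset_right)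
        (fun U V _ _ h => by
          simp only [union_inter_distrib_right]
          exact famSup_sup m p f (h.mono inter_subset_left inter_subset_left))
      refine (hν.2.2 ν' hreg ?_ Ω subset_rfl).trans ?_
      · intro S hS φ hφ
        rw [hν']
        refine le_iInf fun U => le_iInf fun hU => le_iInf fun hSU => ?_
        have h : cheegerSet m p Ω (φ ∘ f) S ≤ cheegerOpen m p (φ ∘ f) (U ∩ Ω) :=
          iInf_le_of_le (U ∩ Ω) <| iInf_le_of_le (hU.inter hΩ) <|
          iInf_le_of_le inter_subset_right <| iInf_le_of_le (subset_inter hSU hS) le_rfl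
        exact h.trans (le_famSup m p f (hU.inter hΩ) hφ)
      · rw [hν']
        refine le_trans (b := famSup m p f (Ω ∩ Ω))
          (iInf_le_of_le Ω <| iInf_le_of_le hΩ <| iInf_le_of_le subset_rfl le_rfl) ?_
        rw [inter_self]
        refine iSup_le ?_
        rintro ⟨⟨O, φ⟩, h⟩
        refine le_trans ?_ (le_iSup _ ⟨(O, φ), h⟩)
        refine ENNReal.tsum_le_tsum fun j => ?_
        exact (cheegerSet_eq m p _ (h.1 j).1 (h.1 j).2).ge
    · refine iSup_le ?_
      rintro ⟨⟨O, φ⟩, h1, h2, h3⟩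
      simp only at h1 h2 h3 ⊢
      refine (ENNReal.tsum_le_tsum fun j => hν.2.1 (O j) (h1 j).2 (φ j) (h3 j)).trans ?_
      rw [← OuterMeasure.iUnion_eq_of_caratheodory ν (fun j => hcar _ (h1 j).1.measurableSet) h2]
      exact measure_mono (iUnion_subset fun j => (h1 j).2)

end BBM
end
end

section
/- Suppose X is internally doubling. Then supp(m) = X, and for every S ⋐ X and every x ∈ S, the closed ball B(x,R) is compact, where R := (1/2)·min{dist(S, X̄\X), R_D(S)}. -/
open MeasureTheory Filter Metric Set Topology
open scoped ENNReal NNReal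

noncomputable section

namespace BBM

variable {X : Type*} [MetricSpace X]

variable [MeasurableSpace X]

theorem aux_mem_range {X : Type*} [MetricSpace X] {x : X} {r : ℝ}
    (hc : IsComplete (closedBall x r)) {z : UniformSpace.Completion X}
    (hz : dist (x : UniformSpace.Completion X) z < r) :
    ∃ a : X, (a : UniformSpace.Completion X) = z := by
  have himg : IsClosed ((fun a : X => (a : UniformSpace.Completion X)) '' closedBall x r) := by
    apply IsComplete.isClosed
    exact (IsUniformInducing.isComplete_iff
      (UniformSpace.Completion.coe_isometry.isUniformInducing)).2 hc
  have hzc : z ∈ closure ((fun a : X => (a : UniformSpace.Completion X)) '' closedBall x r) := by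
    rw [Metric.mem_closure_iff]
    intro ε hε
    obtain ⟨a, ha⟩ := (UniformSpace.Completion.denseRange_coe (α := X)).exists_dist_lt z
      (lt_min hε (sub_pos.2 hz))
    refine ⟨a, ⟨a, ?_, rfl⟩, ha.trans_le (min_le_left _ _)⟩
    rw [mem_closedBall, dist_comm, ← UniformSpace.Completion.dist_eq]
    have h1 := ha.trans_le (min_le_right _ _)
    have h2 := dist_triangle (x : UniformSpace.Completion X) z (a : UniformSpace.Completion X)
    linarith
  rw [himg.closure_eq] at hzc
  obtain ⟨a, -, ha⟩ := hzc
  exact ⟨a, ha⟩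

theorem aux_wellInside {X : Type*} [MetricSpace X]
    (hloc : ∀ x : X, ∃ r > 0, IsComplete (closedBall x r)) (x : X) :
    WellInside ({x} : Set X) univ := by
  refine ⟨subset_univ _, ?_⟩
  obtain ⟨r, hr, hc⟩ := hloc x
  refine (ENNReal.ofReal_pos.2 hr).trans_le ?_
  unfold compDist
  refine le_iInf fun y => le_iInf fun hy => le_iInf fun z => le_iInf fun hz => ?_
  rw [mem_singleton_iff] at hy
  subst hy
  by_contra hlt
  rw [not_le, edist_dist, ENNReal.ofReal_lt_ofReal_iff hr] at hlt
  obtain ⟨a, ha⟩ := aux_mem_range hc hlt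
  exact hz ⟨a, mem_univ _, ha⟩

theorem aux_mem_setBall {X : Type*} [MetricSpace X] {S : Set X} {x y : X} {R : ℝ}
    (hx : x ∈ S) (h : dist y x ≤ R) : y ∈ setBall S R := by
  have h1 : Metric.infEDist y S ≤ edist y x := Metric.infEDist_le_edist_of_mem hx
  have h2 : edist y x ≤ ENNReal.ofReal R := by
    rw [edist_dist]; exact ENNReal.ofReal_le_ofReal h
  exact h1.trans h2

theorem aux_complete {X : Type*} [MetricSpace X] {S : Set X} {x : X} {R : ℝ} (hx : x ∈ S)
    (hR : 0 < R) (h : ENNReal.ofReal (2 * R) ≤ compDist S Set.univ) :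
    IsComplete (closedBall x R) := by
  have hi : IsUniformInducing (fun a : X => (a : UniformSpace.Completion X)) :=
    UniformSpace.Completion.coe_isometry.isUniformInducing
  rw [← isComplete_image_iff hi]
  apply IsClosed.isComplete
  have : (fun a : X => (a : UniformSpace.Completion X)) '' closedBall x R
      = closedBall (x : UniformSpace.Completion X) R := by
    ext z
    constructor
    · rintro ⟨a, ha, rfl⟩
      simpa [UniformSpace.Completion.dist_eq] using ha
    · intro hz
      by_cases hza : z ∈ (fun a : X => (a : UniformSpace.Completion X)) '' univ
      · obtain ⟨a, -, rfl⟩ := hza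
        refine ⟨a, ?_, rfl⟩
        simpa [UniformSpace.Completion.dist_eq] using hz
      · exfalso
        have h1 : compDist S Set.univ ≤ edist (x : UniformSpace.Completion X) z :=
          (iInf₂_le x hx).trans (iInf₂_le z hza)
        have h2 := h.trans h1
        rw [edist_dist, ENNReal.ofReal_le_ofReal_iff dist_nonneg, dist_comm] at h2
        rw [mem_closedBall] at hz
        linarith
  rw [this]
  exact isClosed_closedBall

theorem aux_iter {X : Type*} [MetricSpace X] [MeasurableSpace X] {m : Measure X} {C_D : ℝ≥0}
    {S : Set X} {R_D : ℝ} (hD : DoublingOn m C_D S R_D) {y : X} (hy : y ∈ setBall S R_D)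
    {R : ℝ} (hR : 0 < R) (hRD : R ≤ R_D / 2) (k : ℕ) :
    m (closedBall y (2 * R)) ≤ (C_D : ℝ≥0∞) ^ k * m (closedBall y (2 * R / 2 ^ k)) := by
  induction k with
  | zero => simp
  | succ k ih =>
    refine ih.trans ?_
    have hle : 2 * R / 2 ^ (k + 1) ≤ R_D := by
      have : 2 * R / 2 ^ (k + 1) ≤ 2 * R :=
        div_le_self (by positivity) (one_le_pow₀ (by norm_num))
      linarith
    have h := (hD y hy (2 * R / 2 ^ (k + 1)) (by positivity) hle).2.1
    have he : 2 * (2 * R / 2 ^ (k + 1)) = 2 * R / 2 ^ k := by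
      field_simp; ring
    rw [he] at h
    rw [pow_succ, mul_assoc]
    gcongr

theorem aux_totallyBounded {X : Type*} [MetricSpace X] [MeasurableSpace X] [BorelSpace X]
    {m : Measure X} {C_D : ℝ≥0}
    {S : Set X} {R_D : ℝ} (hD : DoublingOn m C_D S R_D) {x : X} (hx : x ∈ S)
    {R : ℝ} (hR : 0 < R) (hRD : R ≤ R_D / 2) : TotallyBounded (closedBall x R) := by
  rw [Metric.totallyBounded_iff]
  by_contra! hcon
  obtain ⟨ε, hε, hcon⟩ := hcon
  have hxs : x ∈ setBall S R_D := aux_mem_setBall hx (by rw [dist_self]; linarith)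
  have hex : ∀ t : Set X, t.Finite → ∃ c, c ∈ closedBall x R ∧ ∀ y ∈ t, ε ≤ dist c y := by
    intro t ht
    obtain ⟨c, hc, hct⟩ := not_subset.1 (hcon t ht)
    refine ⟨c, hc, fun y hy => ?_⟩
    by_contra hlt
    exact hct (mem_iUnion₂.2 ⟨y, hy, not_le.1 hlt⟩)
  obtain ⟨u, hu⟩ := seq_of_forall_finite_exists hex
  have husep : ∀ i j, i ≠ j → ε ≤ dist (u i) (u j) := by
    intro i j hij
    rcases lt_or_gt_of_ne hij with h | h
    · rw [dist_comm]; exact (hu j).2 _ ⟨i, h, rfl⟩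
    · exact (hu i).2 _ ⟨j, h, rfl⟩
  obtain ⟨k, hk⟩ := exists_pow_lt_of_lt_one (show 0 < ε / (2 * R) by positivity)
    (show (1 / 2 : ℝ) < 1 by norm_num)
  rw [lt_div_iff₀ (by positivity)] at hk
  set ρ : ℝ := 2 * R / 2 ^ (k + 1) with hρ
  have hρ2 : 2 * ρ < ε := by
    have : 2 * ρ = (1 / 2) ^ k * (2 * R) := by
      rw [hρ, one_div, inv_pow]; field_simp; ring
    rw [this]; exact hk
  have hρR : ρ ≤ R := by
    have : ρ = R / 2 ^ k := by rw [hρ]; field_simp; ring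
    rw [this]
    exact div_le_self hR.le (one_le_pow₀ (by norm_num))
  have hpos : 0 < m (closedBall x R) := by
    have := (hD x hxs (R / 2) (by positivity) (by linarith)).1
    rwa [show 2 * (R / 2) = R by ring] at this
  have hfin : m (closedBall x (2 * R)) < ⊤ :=
    (hD x hxs (2 * R) (by positivity) (by linarith)).2.2
  have hC : ((C_D : ℝ≥0∞) ^ (k + 1)) ≠ ⊤ := by finiteness
  have hlow : ∀ i, m (closedBall x R) / (C_D : ℝ≥0∞) ^ (k + 1) ≤ m (closedBall (u i) ρ) := by
    intro i
    have hui := (hu i).1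
    rw [mem_closedBall] at hui
    apply ENNReal.div_le_of_le_mul'
    refine le_trans (measure_mono ?_)
      (aux_iter hD (aux_mem_setBall hx (by linarith)) hR hRD (k + 1))
    apply closedBall_subset_closedBall'
    rw [dist_comm]; linarith
  have hF := Measure.finite_const_le_meas_of_disjoint_iUnion m
    (ENNReal.div_pos hpos.ne' hC) (As := fun i => closedBall (u i) ρ)
    (fun i => measurableSet_closedBall)
    (fun i j hij => closedBall_disjoint_closedBall (by have := husep i j hij; linarith))
    (ne_top_of_le_ne_top hfin.ne (measure_mono (iUnion_subset fun i => by
      apply closedBall_subset_closedBall'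
      have hui := (hu i).1
      rw [mem_closedBall] at hui
      linarith)))
  rw [show {i | m (closedBall x R) / (C_D : ℝ≥0∞) ^ (k + 1) ≤ m (closedBall (u i) ρ)} = univ from
    eq_univ_of_forall hlow] at hF
  exact infinite_univ hF

theorem statement14
    {X : Type*} [MetricSpace X] [TopologicalSpace.SeparableSpace X] [ConnectedSpace X]
    [Nontrivial X] [MeasurableSpace X] [BorelSpace X]
    (hloc : ∀ x : X, ∃ r > 0, IsComplete (closedBall x r))
    (m : Measure X) [IsLocallyFiniteMeasure m] (hm : m ≠ 0)
    (C_D : ℝ≥0) (hD : InternallyDoubling m C_D) :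
    (∀ x : X, ∀ r : ℝ, 0 < r → 0 < m (ball x r)) ∧
    ∀ S : Set X, WellInside S Set.univ →
      ∀ R_D : ℝ, 0 < R_D → DoublingOn m C_D S R_D →
      ∀ x ∈ S, ∀ R : ℝ, 0 < R → R ≤ R_D / 2 →
        ENNReal.ofReal (2 * R) ≤ compDist S Set.univ → IsCompact (closedBall x R) := by
  refine ⟨fun x r hr => ?_, fun S _ R_D _ hDS x hx R hR hRD hdist => ?_⟩
  · obtain ⟨R, hR, hDR⟩ := hD.2 {x} (aux_wellInside hloc x)
    have h := (hDR x (aux_mem_setBall (mem_singleton x) (by rw [dist_self]; exact hR.le))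
      (min R (r / 4)) (lt_min hR (by positivity)) (min_le_left _ _)).1
    refine h.trans_le (measure_mono (closedBall_subset_ball ?_))
    have := min_le_right R (r / 4)
    linarith
  · exact isCompact_iff_totallyBounded_isComplete.2
      ⟨aux_totallyBounded hDS hx hR hRD, aux_complete hx hR hdist⟩


end BBM
end
end

section
/- Let p ∈ [1,∞) and suppose X is internally doubling with constant C_D. Let Ω ⊆ X be open, (Y,d_Y) a metric space, f ∈ 𝔅(Ω,Y). Fix a Borel set E ⋐ Ω and put R := (1/16)·min{dist(E, X̄\Ω), R_D(E)}. Then: (i) if E_p[f](Ω) < ∞, then for every r ∈ (0,R]: max{∫_E A_p[f](x,r) dm(x), ∫_E R_p[f](x,r) dm(x)} ≤ C_D·E_p[f](B(E,r)); (ii) if f ∈ S^{1,p}(Ω,Y), then the families (A_p[f](·,r))_{r∈(0,R)} and (R_p[f](·,r))_{r∈(0,R)} converge to |∇f|_p^p in L¹(E) as r ↘ 0; (iii) if E_p[f](Ω) < ∞, then for every r ∈ (0,R], M_p[f](·,r) is finite m-a.e. on E. -/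
open MeasureTheory Filter Metric Set Topology
open scoped ENNReal NNReal

noncomputable section

namespace BBM

variable {X : Type*} [MetricSpace X]

variable [MeasurableSpace X]

/-- Local doubling on `E` at scales up to `R`. -/
def Dbl (m : Measure X) (C : ℝ≥0) (E : Set X) (R : ℝ) : Prop :=
  ∀ x ∈ E, ∀ r : ℝ, 0 < r → r ≤ R → 0 < m (closedBall x r) ∧
    m (closedBall x (2 * r)) ≤ (C : ℝ≥0∞) * m (closedBall x r) ∧ m (closedBall x r) < ⊤

/-- Averages of `μ` with respect to `m`. -/
def Av (m μ : Measure X) (x : X) (r : ℝ) : ℝ≥0∞ := μ (closedBall x r) / m (closedBall x r)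

lemma mem_setBall_iff {S : Set X} {r : ℝ} {y : X} :
    y ∈ setBall S r ↔ Metric.infEDist y S ≤ ENNReal.ofReal r := Iff.rfl

lemma mem_setBall_of_dist {S : Set X} {r : ℝ} {x y : X} (hx : x ∈ S) (h : dist y x ≤ r) :
    y ∈ setBall S r := by
  rw [mem_setBall_iff]
  refine (Metric.infEDist_le_edist_of_mem hx).trans ?_
  rw [edist_dist]
  exact ENNReal.ofReal_le_ofReal h

lemma exists_dist_of_mem_setBall {S : Set X} {r r' : ℝ} {y : X} (hr : 0 ≤ r)
    (h : y ∈ setBall S r) (hrr : r < r') : ∃ x ∈ S, dist y x < r' := by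
  rw [mem_setBall_iff] at h
  have h2 : Metric.infEDist y S < ENNReal.ofReal r' :=
    h.trans_lt ((ENNReal.ofReal_lt_ofReal_iff (by linarith)).2 hrr)
  obtain ⟨x, hx, hd⟩ := Metric.infEDist_lt_iff.1 h2
  refine ⟨x, hx, ?_⟩
  rw [edist_dist] at hd
  exact (ENNReal.ofReal_lt_ofReal_iff (by linarith)).1 hd

lemma isClosed_setBall (S : Set X) (r : ℝ) : IsClosed (setBall S r) :=
  isClosed_le Metric.continuous_infEDist continuous_const

lemma setBall_mono_left {S T : Set X} (h : S ⊆ T) (r : ℝ) : setBall S r ⊆ setBall T r := by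
  intro y hy
  rw [mem_setBall_iff] at *
  exact (Metric.infEDist_anti h).trans hy

lemma setBall_mono_right (S : Set X) {r r' : ℝ} (h : r ≤ r') : setBall S r ⊆ setBall S r' := by
  intro y hy
  rw [mem_setBall_iff] at *
  exact hy.trans (ENNReal.ofReal_le_ofReal h)

lemma eabs_le_iff {a b c : ℝ≥0∞} : eabs a b ≤ c ↔ a ≤ b + c ∧ b ≤ a + c := by
  unfold eabs
  rw [sup_le_iff, tsub_le_iff_left, tsub_le_iff_left]

lemma le_add_eabs (a b : ℝ≥0∞) : a ≤ b + eabs a b := (eabs_le_iff.1 le_rfl).1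
lemma le_add_eabs' (a b : ℝ≥0∞) : b ≤ a + eabs a b := (eabs_le_iff.1 le_rfl).2

lemma eabs_triangle (a b c : ℝ≥0∞) : eabs a c ≤ eabs a b + eabs b c := by
  rw [eabs_le_iff]
  constructor
  · calc a ≤ b + eabs a b := le_add_eabs _ _
      _ ≤ (c + eabs b c) + eabs a b := by gcongr; exact le_add_eabs _ _
      _ = _ := by ring
  · calc c ≤ b + eabs b c := le_add_eabs' _ _
      _ ≤ (a + eabs a b) + eabs b c := by gcongr; exact le_add_eabs' _ _
      _ = _ := by ring

lemma eabs_comm (a b : ℝ≥0∞) : eabs a b = eabs b a := by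
  unfold eabs; rw [sup_comm]

lemma eabs_le_add (a b : ℝ≥0∞) : eabs a b ≤ a + b := by
  rw [eabs_le_iff]
  exact ⟨le_add_left le_self_add, le_add_left le_add_self⟩

lemma eabs_le_max {a b c : ℝ≥0∞} (ha : a ≤ c) (hb : b ≤ c) : eabs a b ≤ c := by
  rw [eabs_le_iff]
  exact ⟨le_add_left ha, le_add_left hb⟩

lemma measurable_eabs {f g : X → ℝ≥0∞} (hf : Measurable f) (hg : Measurable g) :
    Measurable fun x => eabs (f x) (g x) := (hf.sub hg).sup (hg.sub hf)

section helpers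
variable [TopologicalSpace.SeparableSpace X] [BorelSpace X]

lemma measurable_ball_meas (μ : Measure X) [SFinite μ] (r : ℝ) :
    Measurable fun x => μ (closedBall x r) := by
  haveI : SecondCountableTopology X := UniformSpace.secondCountable_of_separable X
  have hc : IsClosed {q : X × X | dist q.2 q.1 ≤ r} :=
    isClosed_le (by fun_prop) continuous_const
  exact measurable_measure_prodMk_left hc.measurableSet

lemma measurable_Av (m μ : Measure X) [SFinite m] [SFinite μ] (r : ℝ) :
    Measurable fun x => Av m μ x r :=
  (measurable_ball_meas μ r).div (measurable_ball_meas m r)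

lemma Av_L1 (m μ : Measure X) [SFinite m] [SFinite μ] {C : ℝ≥0} (hC : 1 ≤ C) {E : Set X}
    (hE : MeasurableSet E) {R : ℝ} (h : Dbl m C E R) {r : ℝ} (hr : 0 < r) (hrR : r ≤ R) :
    ∫⁻ x in E, Av m μ x r ∂m ≤ C * μ (setBall E r) := by
  haveI : SecondCountableTopology X := UniformSpace.secondCountable_of_separable X
  have hc : IsClosed {q : X × X | dist q.2 q.1 ≤ r} :=
    isClosed_le (by fun_prop) continuous_const
  have hC0 : (C : ℝ≥0∞) ≠ 0 := by
    have : C ≠ 0 := (lt_of_lt_of_le one_pos hC).ne'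
    exact_mod_cast this
  let k : X → X → ℝ≥0∞ := fun x y =>
    Set.indicator {q : X × X | dist q.2 q.1 ≤ r} (fun q => (m (closedBall q.1 r))⁻¹) (x, y)
  have hk : Measurable (Function.uncurry k) :=
    (Measurable.indicator (((measurable_ball_meas m r).comp measurable_fst).inv) hc.measurableSet)
  have e1 : ∀ x, Av m μ x r = ∫⁻ y, k x y ∂μ := by
    intro x
    have : (fun y => k x y) = (closedBall x r).indicator fun _ => (m (closedBall x r))⁻¹ := by
      funext y
      simp only [k, Set.indicator, mem_setOf_eq, mem_closedBall]
    rw [this, lintegral_indicator_const isClosed_closedBall.measurableSet, Av, div_eq_mul_inv,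
      mul_comm]
  have e2 : ∀ y, ∫⁻ x in E, k x y ∂m ≤ (setBall E r).indicator (fun _ => (C : ℝ≥0∞)) y := by
    intro y
    by_cases hy : y ∈ setBall E r
    · rw [Set.indicator_of_mem hy]
      calc ∫⁻ x in E, k x y ∂m
          ≤ ∫⁻ x in E, (closedBall y r).indicator
              (fun _ => C * (m (closedBall y r))⁻¹) x ∂m := by
            refine setLIntegral_mono' hE fun x hx => ?_
            simp only [k, Set.indicator, mem_setOf_eq, mem_closedBall]
            rw [dist_comm y x]
            split_ifs with hd
            · have hsub : closedBall y r ⊆ closedBall x (2 * r) := by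
                intro z hz
                rw [mem_closedBall] at *
                have := dist_triangle z y x
                rw [dist_comm y x] at this
                linarith
              have h1 : m (closedBall y r) ≤ C * m (closedBall x r) :=
                (measure_mono hsub).trans (h x hx r hr hrR).2.1
              have h2 := ENNReal.inv_le_inv.2 h1
              rw [ENNReal.mul_inv (Or.inl hC0) (Or.inl ENNReal.coe_ne_top)] at h2
              calc (m (closedBall x r))⁻¹
                  = C * ((C : ℝ≥0∞)⁻¹ * (m (closedBall x r))⁻¹) := by
                    rw [← mul_assoc, ENNReal.mul_inv_cancel hC0 ENNReal.coe_ne_top, one_mul]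
                _ ≤ _ := by gcongr
            · exact le_rfl
        _ ≤ ∫⁻ x, (closedBall y r).indicator
              (fun _ => C * (m (closedBall y r))⁻¹) x ∂m := setLIntegral_le_lintegral _ _
        _ = C * ((m (closedBall y r))⁻¹ * m (closedBall y r)) := by
            rw [lintegral_indicator_const isClosed_closedBall.measurableSet, mul_assoc]
        _ ≤ C * 1 := by gcongr; exact ENNReal.inv_mul_le_one _
        _ = C := mul_one _
    · rw [Set.indicator_of_notMem hy]
      refine le_of_eq ?_
      rw [← lintegral_zero (μ := m.restrict E)]
      refine setLIntegral_congr_fun hE fun x hx => ?_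
      simp only [k]
      apply Set.indicator_of_notMem
      intro hd
      exact hy (mem_setBall_of_dist hx hd)
  calc ∫⁻ x in E, Av m μ x r ∂m = ∫⁻ x in E, ∫⁻ y, k x y ∂μ ∂m := by simp_rw [e1]
    _ = ∫⁻ y, ∫⁻ x in E, k x y ∂m ∂μ := lintegral_lintegral_swap hk.aemeasurable
    _ ≤ ∫⁻ y, (setBall E r).indicator (fun _ => (C : ℝ≥0∞)) y ∂μ := lintegral_mono e2
    _ = C * μ (setBall E r) := lintegral_indicator_const (isClosed_setBall E r).measurableSet _

lemma weak_type (m μ : Measure X) {C : ℝ≥0} {E : Set X}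
    {R : ℝ} (h : Dbl m C E (8 * R)) (t : ℝ≥0∞) (ht : t ≠ 0) (ht' : t ≠ ⊤) :
    m {x ∈ E | ∃ r, 0 < r ∧ r ≤ R ∧ t < Av m μ x r} ≤ C ^ 3 * (μ univ / t) := by
  set S := {x ∈ E | ∃ r, 0 < r ∧ r ≤ R ∧ t < Av m μ x r} with hS
  have hex : ∀ x : X, ∃ r : ℝ, x ∈ S → 0 < r ∧ r ≤ R ∧ t < Av m μ x r := by
    intro x
    by_cases hx : x ∈ S
    · obtain ⟨r, hr⟩ := hx.2
      exact ⟨r, fun _ => hr⟩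
    · exact ⟨0, fun h => absurd h hx⟩
  choose ρ hρ using hex
  obtain ⟨u, huS, hdisj, hcov⟩ := Vitali.exists_disjoint_subfamily_covering_enlargement_closedBall
    S (fun x => x) ρ R (fun a ha => (hρ a ha).2.1) 5 (by norm_num)
  have hcount : u.Countable := hdisj.countable_of_nonempty_interior fun i hi =>
    ⟨i, ball_subset_interior_closedBall (mem_ball_self (hρ i (huS hi)).1)⟩
  have hsub : S ⊆ ⋃ b ∈ u, closedBall b (5 * ρ b) := by
    intro x hx
    obtain ⟨b, hb, hsubb⟩ := hcov x hx
    exact mem_iUnion₂.2 ⟨b, hb, hsubb (mem_closedBall_self (hρ x hx).1.le)⟩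
  have hone : ∀ b ∈ u, m (closedBall b (5 * ρ b)) ≤ C ^ 3 * (μ (closedBall b (ρ b)) / t) := by
    intro b hb
    obtain ⟨h0, hR, hA⟩ := hρ b (huS hb)
    have hbE : b ∈ E := (huS hb).1
    have d1 := h b hbE (ρ b) h0 (by linarith)
    have d2 := h b hbE (2 * ρ b) (by linarith) (by linarith)
    have d3 := h b hbE (2 * (2 * ρ b)) (by linarith) (by linarith)
    have hm1 : m (closedBall b (ρ b)) ≤ μ (closedBall b (ρ b)) / t := by
      rw [ENNReal.le_div_iff_mul_le (Or.inl ht) (Or.inl ht'), mul_comm]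
      exact ENNReal.mul_le_of_le_div hA.le
    calc m (closedBall b (5 * ρ b)) ≤ m (closedBall b (2 * (2 * (2 * ρ b)))) :=
          measure_mono (closedBall_subset_closedBall (by linarith))
      _ ≤ C * (C * (C * m (closedBall b (ρ b)))) := by
          refine d3.2.1.trans ?_
          gcongr
          refine d2.2.1.trans ?_
          gcongr
          exact d1.2.1
      _ = C ^ 3 * m (closedBall b (ρ b)) := by ring
      _ ≤ _ := by gcongr
  haveI := hcount.to_subtype
  calc m S ≤ m (⋃ b ∈ u, closedBall b (5 * ρ b)) := measure_mono hsub
    _ ≤ ∑' b : u, m (closedBall (b : X) (5 * ρ b)) := measure_biUnion_le m hcount _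
    _ ≤ ∑' b : u, C ^ 3 * (μ (closedBall (b : X) (ρ b)) / t) :=
        ENNReal.tsum_le_tsum fun b => hone b b.2
    _ = C ^ 3 * ((∑' b : u, μ (closedBall (b : X) (ρ b))) / t) := by
        rw [ENNReal.tsum_mul_left]
        simp_rw [div_eq_mul_inv]
        rw [ENNReal.tsum_mul_right]
    _ = C ^ 3 * (μ (⋃ b ∈ u, closedBall b (ρ b)) / t) := by
        rw [measure_biUnion hcount hdisj fun _ _ => isClosed_closedBall.measurableSet]
    _ ≤ _ := by gcongr; exact subset_univ _

lemma max_finite (m μ : Measure X) [IsFiniteMeasure μ] {C : ℝ≥0} {E : Set X}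
    (hE : MeasurableSet E) {R : ℝ} (h : Dbl m C E (8 * R)) :
    ∀ᵐ x ∂m.restrict E, (⨆ r ∈ Ioc (0 : ℝ) R, Av m μ x r) < ⊤ := by
  rw [ae_restrict_iff' hE, ae_iff]
  have hb : ∀ n : ℕ, m {x | ¬(x ∈ E → (⨆ r ∈ Ioc (0 : ℝ) R, Av m μ x r) < ⊤)} ≤
      C ^ 3 * (μ univ / ((n + 1 : ℕ) : ℝ≥0∞)) := by
    intro n
    refine (measure_mono ?_).trans (weak_type m μ h ((n + 1 : ℕ) : ℝ≥0∞)
      (by simp) (ENNReal.natCast_ne_top _))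
    intro x hx
    simp only [mem_setOf_eq, Classical.not_imp, not_lt, top_le_iff] at hx
    refine ⟨hx.1, ?_⟩
    have : ((n + 1 : ℕ) : ℝ≥0∞) < ⨆ r ∈ Ioc (0 : ℝ) R, Av m μ x r := by
      rw [hx.2]; exact ENNReal.natCast_lt_top _
    obtain ⟨r, hr⟩ := lt_iSup_iff.1 this
    obtain ⟨hr', hr2⟩ := lt_iSup_iff.1 hr
    exact ⟨r, hr'.1, hr'.2, hr2⟩
  have hlim : Tendsto (fun n : ℕ => (C : ℝ≥0∞) ^ 3 * (μ univ / ((n + 1 : ℕ) : ℝ≥0∞))) atTop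
      (𝓝 0) := by
    have h1 : Tendsto (fun n : ℕ => μ univ / ((n + 1 : ℕ) : ℝ≥0∞)) atTop (𝓝 0) := by
      have := ENNReal.Tendsto.const_div (a := μ univ)
        (ENNReal.tendsto_nat_nhds_top.comp (tendsto_add_atTop_nat 1))
        (Or.inr (measure_ne_top μ univ))
      simpa using this
    have := ENNReal.Tendsto.const_mul (a := (C : ℝ≥0∞) ^ 3) h1
      (Or.inr (ENNReal.pow_ne_top ENNReal.coe_ne_top))
    simpa using this
  exact le_antisymm (ge_of_tendsto' hlim hb) bot_le

lemma exhaust_s15 (m μ : Measure X) [IsFiniteMeasure μ] {C : ℝ≥0} {E : Set X}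
    (hE : MeasurableSet E) {ρ : ℝ} (hρ : 0 < ρ) (h : Dbl m C E (4 * ρ)) {ε : ℝ≥0∞} (hε : ε ≠ 0) :
    ∃ F ⊆ E, MeasurableSet F ∧ m F < ⊤ ∧ μ (setBall (E \ F) ρ) ≤ ε := by
  rcases E.eq_empty_or_nonempty with rfl | hne
  · refine ⟨∅, le_rfl, MeasurableSet.empty, by simp, ?_⟩
    have : setBall (∅ \ ∅ : Set X) ρ = ∅ := by
      ext y
      rw [mem_setBall_iff]
      simp
    rw [this]; simp
  have : SecondCountableTopology X := UniformSpace.secondCountable_of_separable X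
  have : Nonempty E := hne.to_subtype
  let s : ℕ → E := TopologicalSpace.denseSeq E
  let F : ℕ → Set X := fun n => E ∩ ⋃ i ∈ Finset.range n, closedBall (s i : X) (4 * ρ)
  have hFmono : Monotone F := by
    intro a b hab
    refine inter_subset_inter_right _ ?_
    refine biUnion_subset_biUnion_left ?_
    intro i hi
    simp only [Finset.coe_range, mem_Iio, Finset.mem_range, SetLike.mem_coe] at *
    have hi' : i < a := by simpa using hi
    simpa using (show i < b by omega)
  have hanti : Antitone fun n => setBall (E \ F n) ρ := fun a b hab =>
    setBall_mono_left (diff_subset_diff_right (hFmono hab)) ρ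
  have hlim := tendsto_measure_iInter_atTop (μ := μ) (s := fun n => setBall (E \ F n) ρ)
    (fun n => (isClosed_setBall _ _).measurableSet.nullMeasurableSet) hanti
    ⟨0, measure_ne_top _ _⟩
  have hempty : ⋂ n, setBall (E \ F n) ρ = ∅ := by
    rw [eq_empty_iff_forall_notMem]
    intro y hy
    rw [mem_iInter] at hy
    obtain ⟨x, hx, hxy⟩ := exists_dist_of_mem_setBall hρ.le (hy 0) (show ρ < 3 / 2 * ρ by linarith)
    obtain ⟨i, hi⟩ := (TopologicalSpace.denseRange_denseSeq E).exists_dist_lt ⟨x, hx.1⟩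
      (show 0 < ρ / 2 by linarith)
    obtain ⟨z, hz, hzy⟩ := exists_dist_of_mem_setBall hρ.le (hy (i + 1))
      (show ρ < 3 / 2 * ρ by linarith)
    apply hz.2
    refine ⟨hz.1, mem_iUnion₂.2 ⟨i, by simp, ?_⟩⟩
    rw [mem_closedBall]
    have h1 : dist x (s i : X) < ρ / 2 := hi
    have h2 := dist_triangle z y (s i : X)
    have h3 := dist_triangle y x (s i : X)
    rw [dist_comm z y] at h2
    linarith
  rw [hempty, measure_empty] at hlim
  obtain ⟨n, hn⟩ := (hlim.eventually (Iic_mem_nhds (pos_iff_ne_zero.2 hε))).exists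
  refine ⟨F n, inter_subset_left, ?_, ?_, hn⟩
  · exact hE.inter (Finset.measurableSet_biUnion _ fun _ _ => isClosed_closedBall.measurableSet)
  · refine (measure_mono inter_subset_right).trans_lt ?_
    refine (measure_biUnion_finset_le _ _).trans_lt ?_
    exact ENNReal.sum_lt_top.2 fun i _ => (h (s i) (s i).2 (4 * ρ) (by linarith) le_rfl).2.2

lemma Av_eabs (m : Measure X) (G H : X → ℝ≥0∞) (hG : Measurable G) (hH : Measurable H)
    (x : X) (r : ℝ) :
    eabs (Av m (m.withDensity G) x r) (Av m (m.withDensity H) x r) ≤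
      Av m (m.withDensity fun y => eabs (G y) (H y)) x r := by
  have hB : MeasurableSet (closedBall x r) := isClosed_closedBall.measurableSet
  rw [eabs_le_iff]
  simp only [Av, withDensity_apply _ hB]
  rw [ENNReal.div_add_div_same, ENNReal.div_add_div_same, ← lintegral_add_left hH,
    ← lintegral_add_left hG]
  constructor
  · gcongr; exact le_add_eabs _ _
  · gcongr; exact le_add_eabs' _ _

lemma Av_const_le (m : Measure X) (H : X → ℝ≥0∞) (x : X) (r : ℝ) (c : ℝ≥0∞)
    (hc : ∀ y ∈ closedBall x r, H y ≤ c) : Av m (m.withDensity H) x r ≤ c := by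
  have hB : MeasurableSet (closedBall x r) := isClosed_closedBall.measurableSet
  rw [Av, withDensity_apply _ hB]
  refine ENNReal.div_le_of_le_mul ?_
  calc ∫⁻ y in closedBall x r, H y ∂m ≤ ∫⁻ y in closedBall x r, c ∂m :=
        setLIntegral_mono' hB hc
    _ = _ := by simp

lemma Av_le_const (m : Measure X) (H : X → ℝ≥0∞) (x : X) (r : ℝ) (c : ℝ≥0∞)
    (h0 : 0 < m (closedBall x r)) (h1 : m (closedBall x r) < ⊤)
    (hc : ∀ y ∈ closedBall x r, c ≤ H y) : c ≤ Av m (m.withDensity H) x r := by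
  have hB : MeasurableSet (closedBall x r) := isClosed_closedBall.measurableSet
  rw [Av, withDensity_apply _ hB, ENNReal.le_div_iff_mul_le (Or.inl h0.ne') (Or.inl h1.ne)]
  calc c * m (closedBall x r) = ∫⁻ y in closedBall x r, c ∂m := by simp
    _ ≤ _ := setLIntegral_mono' hB hc

lemma conv_cont (m : Measure X) [IsLocallyFiniteMeasure m] {C : ℝ≥0} {F : Set X}
    (hF : MeasurableSet F) (hFm : m F < ⊤) {R : ℝ} (hR : 0 < R) (h : Dbl m C F R)
    (H : X → ℝ≥0∞) (hH : Continuous H) (M : ℝ≥0∞) (hM : M ≠ ⊤) (hHM : ∀ x, H x ≤ M) :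
    Tendsto (fun r => ∫⁻ x in F, eabs (Av m (m.withDensity H) x r) (H x) ∂m) (𝓝[>] (0 : ℝ))
      (𝓝 0) := by
  have : SecondCountableTopology X := UniformSpace.secondCountable_of_separable X
  have key := tendsto_lintegral_filter_of_dominated_convergence (μ := m.restrict F)
    (l := 𝓝[>] (0 : ℝ)) (F := fun r x => eabs (Av m (m.withDensity H) x r) (H x))
    (f := fun _ => 0) (fun _ => M)
    (Eventually.of_forall fun r => measurable_eabs (measurable_Av _ _ _) hH.measurable)
    (Eventually.of_forall fun r => Eventually.of_forall fun x =>
      eabs_le_max (Av_const_le _ _ _ _ _ fun y _ => hHM y) (hHM x))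
    (by
      simp only [lintegral_const, Measure.restrict_apply_univ]
      exact ENNReal.mul_ne_top hM hFm.ne)
    ((ae_restrict_iff' hF).2 (Eventually.of_forall fun x hx => by
      rw [ENNReal.tendsto_nhds_zero]
      intro ε hε
      have hHx : H x ≠ ⊤ := ((hHM x).trans_lt hM.lt_top).ne
      have hnb := hH.continuousAt.eventually (ENNReal.Icc_mem_nhds hHx hε.ne')
      obtain ⟨δ, hδ, hball⟩ := Metric.eventually_nhds_iff_ball.1 hnb
      have h1 : ∀ᶠ r in 𝓝[>] (0 : ℝ), r < min δ R :=
        mem_nhdsWithin_of_mem_nhds (Iio_mem_nhds (lt_min hδ hR))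
      filter_upwards [h1, self_mem_nhdsWithin] with r hr hr0
      have hr0 : 0 < r := hr0
      have hd := h x hx r hr0 (hr.le.trans (min_le_right _ _))
      have hy : ∀ y ∈ closedBall x r, H y ∈ Icc (H x - ε) (H x + ε) := fun y hy =>
        hball y (closedBall_subset_ball (hr.trans_le (min_le_left _ _)) hy)
      rw [eabs_le_iff]
      constructor
      · exact Av_const_le _ _ _ _ _ fun y hy' => (hy y hy').2
      · rw [← tsub_le_iff_right]
        exact Av_le_const _ _ _ _ _ hd.1 hd.2.2 fun y hy' => (hy y hy').1))
  simpa using key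

lemma approx (m : Measure X) [IsLocallyFiniteMeasure m] (G : X → ℝ≥0∞) (hG : Measurable G)
    (hGf : ∫⁻ x, G x ∂m ≠ ⊤) {ε : ℝ≥0∞} (hε : ε ≠ 0) :
    ∃ H : X → ℝ≥0∞, Continuous H ∧ (∃ M : ℝ≥0∞, M ≠ ⊤ ∧ ∀ x, H x ≤ M) ∧
      ∫⁻ x, eabs (G x) (H x) ∂m ≤ ε := by
  have : SecondCountableTopology X := UniformSpace.secondCountable_of_separable X
  have hint : Integrable (fun x => (G x).toReal) m :=
    integrable_toReal_of_lintegral_ne_top hG.aemeasurable hGf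
  obtain ⟨g, hg, -⟩ := hint.exists_boundedContinuous_lintegral_sub_le hε
  refine ⟨fun x => ENNReal.ofReal (g x), ENNReal.continuous_ofReal.comp g.continuous,
    ⟨ENNReal.ofReal ‖g‖, ENNReal.ofReal_ne_top, fun x => ENNReal.ofReal_le_ofReal
      ((le_abs_self _).trans (g.norm_coe_le_norm x))⟩, ?_⟩
  refine le_trans (lintegral_mono_ae ?_) hg
  filter_upwards [ae_lt_top hG hGf] with x hx
  have hGx : G x = ENNReal.ofReal (G x).toReal := (ENNReal.ofReal_toReal hx.ne).symm
  generalize (G x).toReal = t at *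
  rw [eabs_le_iff, Real.enorm_eq_ofReal_abs, hGx]
  constructor
  · refine le_trans (ENNReal.ofReal_le_ofReal ?_) ENNReal.ofReal_add_le
    have := le_abs_self (t - g x)
    linarith
  · refine le_trans (ENNReal.ofReal_le_ofReal ?_) ENNReal.ofReal_add_le
    have := neg_abs_le (t - g x)
    linarith

lemma conv_A (m : Measure X) [IsLocallyFiniteMeasure m] {C : ℝ≥0} (hC : 1 ≤ C) {E : Set X}
    (hE : MeasurableSet E) {R : ℝ} (hR : 0 < R) (h : Dbl m C E (8 * R))
    (G : X → ℝ≥0∞) (hG : Measurable G) (hGf : ∫⁻ x, G x ∂m ≠ ⊤) :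
    Tendsto (fun r => ∫⁻ x in E, eabs (Av m (m.withDensity G) x r) (G x) ∂m) (𝓝[>] (0 : ℝ))
      (𝓝 0) := by
  have : SecondCountableTopology X := UniformSpace.secondCountable_of_separable X
  have hfin : IsFiniteMeasure (m.withDensity G) := isFiniteMeasure_withDensity hGf
  rw [ENNReal.tendsto_nhds_zero]
  intro ε hε
  -- small parameter
  obtain ⟨η, ⟨hη, hηt⟩, hηε⟩ : ∃ η : ℝ≥0∞, (η ≠ 0 ∧ η ≠ ⊤) ∧ (2 * C + 3) * η ≤ ε := by
    refine ⟨min ε 1 / (2 * C + 3), ⟨?_, ?_⟩, ENNReal.mul_div_le.trans (min_le_left _ _)⟩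
    · refine (ENNReal.div_pos (lt_min hε one_pos).ne' ?_).ne'
      finiteness
    · refine ENNReal.div_ne_top (ne_top_of_le_ne_top ENNReal.one_ne_top (min_le_right _ _)) ?_
      simp
  obtain ⟨F, hFE, hF, hFm, hFtail⟩ := exhaust_s15 m (m.withDensity G) hE hR
    (fun x hx r h0 hr => h x hx r h0 (by linarith)) hη
  obtain ⟨H, hHc, ⟨M, hM, hHM⟩, hGH⟩ := approx m G hG hGf hη
  have hcont := conv_cont m hF hFm (R := 8 * R) (by linarith)
    (fun x hx => h x (hFE hx)) H hHc M hM hHM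
  have hev := ENNReal.tendsto_nhds_zero.1 hcont η (pos_iff_ne_zero.2 hη)
  have hrR : ∀ᶠ r in 𝓝[>] (0 : ℝ), r < R := mem_nhdsWithin_of_mem_nhds (Iio_mem_nhds hR)
  filter_upwards [hev, hrR, self_mem_nhdsWithin] with r hr1 hr2 hr0
  have hr0 : 0 < r := hr0
  have hdF : Dbl m C F (8 * R) := fun x hx => h x (hFE hx)
  have hdT : Dbl m C (E \ F) (8 * R) := fun x hx => h x hx.1
  have hHm : Measurable H := hHc.measurable
  -- tail
  have tail : ∫⁻ x in E \ F, eabs (Av m (m.withDensity G) x r) (G x) ∂m ≤ (C + 1) * η := by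
    calc ∫⁻ x in E \ F, eabs (Av m (m.withDensity G) x r) (G x) ∂m
        ≤ ∫⁻ x in E \ F, (Av m (m.withDensity G) x r + G x) ∂m :=
          lintegral_mono fun x => eabs_le_add _ _
      _ = ∫⁻ x in E \ F, Av m (m.withDensity G) x r ∂m + ∫⁻ x in E \ F, G x ∂m :=
          lintegral_add_left (measurable_Av _ _ _) _
      _ ≤ C * m.withDensity G (setBall (E \ F) r) + m.withDensity G (setBall (E \ F) R) := by
          refine add_le_add (Av_L1 m _ hC (hE.diff hF) hdT hr0 (by linarith)) ?_
          rw [← withDensity_apply _ (hE.diff hF)]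
          refine measure_mono fun x hx => mem_setBall_of_dist hx ?_
          rw [dist_self]; exact hR.le
      _ ≤ C * m.withDensity G (setBall (E \ F) R) + m.withDensity G (setBall (E \ F) R) := by
          gcongr
          exact setBall_mono_right _ hr2.le
      _ ≤ C * η + η := by gcongr
      _ = _ := by ring
  have hDm : Measurable fun y => eabs (G y) (H y) := measurable_eabs hG hHm
  have hDfin : IsFiniteMeasure (m.withDensity fun y => eabs (G y) (H y)) := by
    refine isFiniteMeasure_withDensity (ne_top_of_le_ne_top hηt hGH)
  have main : ∫⁻ x in F, eabs (Av m (m.withDensity G) x r) (G x) ∂m ≤ (C + 2) * η := by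
    calc ∫⁻ x in F, eabs (Av m (m.withDensity G) x r) (G x) ∂m
        ≤ ∫⁻ x in F, (Av m (m.withDensity fun y => eabs (G y) (H y)) x r +
            (eabs (Av m (m.withDensity H) x r) (H x) + eabs (G x) (H x))) ∂m := by
          refine lintegral_mono fun x => ?_
          refine (eabs_triangle _ (Av m (m.withDensity H) x r) _).trans ?_
          refine add_le_add (Av_eabs m G H hG hHm x r) ?_
          refine (eabs_triangle _ (H x) _).trans ?_
          rw [eabs_comm (H x)]
      _ = ∫⁻ x in F, Av m (m.withDensity fun y => eabs (G y) (H y)) x r ∂m +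
            (∫⁻ x in F, eabs (Av m (m.withDensity H) x r) (H x) ∂m +
              ∫⁻ x in F, eabs (G x) (H x) ∂m) := by
          rw [lintegral_add_left (measurable_Av _ _ _), lintegral_add_right _ hDm]
      _ ≤ C * η + (η + η) := by
          refine add_le_add ?_ (add_le_add hr1 ((setLIntegral_le_lintegral _ _).trans hGH))
          refine (Av_L1 m _ hC hF hdF hr0 (by linarith)).trans ?_
          gcongr
          refine (measure_mono (subset_univ _)).trans ?_
          rw [withDensity_apply _ MeasurableSet.univ, Measure.restrict_univ]
          exact hGH
      _ = _ := by ring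
  calc ∫⁻ x in E, eabs (Av m (m.withDensity G) x r) (G x) ∂m
      = ∫⁻ x in F ∪ (E \ F), eabs (Av m (m.withDensity G) x r) (G x) ∂m := by
        rw [union_diff_cancel hFE]
    _ ≤ ∫⁻ x in F, eabs (Av m (m.withDensity G) x r) (G x) ∂m +
        ∫⁻ x in E \ F, eabs (Av m (m.withDensity G) x r) (G x) ∂m := lintegral_union_le _ _ _
    _ ≤ (C + 2) * η + (C + 1) * η := add_le_add main tail
    _ = (2 * C + 3) * η := by ring
    _ ≤ ε := hηε

lemma weights : (3 : ℝ≥0∞)⁻¹ * ∑' k : ℕ, (2 / 3 : ℝ≥0∞) ^ k = 1 := by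
  rw [ENNReal.tsum_geometric]
  have : (1 : ℝ≥0∞) - 2 / 3 = 3⁻¹ := by
    refine ENNReal.sub_eq_of_eq_add (by finiteness) ?_
    rw [div_eq_mul_inv, ← one_add_mul, show (1 : ℝ≥0∞) + 2 = 3 by norm_num,
      ENNReal.mul_inv_cancel (by norm_num) (by finiteness)]
  rw [this, inv_inv, ENNReal.inv_mul_cancel (by norm_num) (by finiteness)]

lemma weighted_le (a : ℕ → ℝ≥0∞) (c : ℝ≥0∞) (h : ∀ k, a k ≤ c) :
    (3 : ℝ≥0∞)⁻¹ * ∑' k : ℕ, (2 / 3 : ℝ≥0∞) ^ k * a k ≤ c := by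
  calc (3 : ℝ≥0∞)⁻¹ * ∑' k : ℕ, (2 / 3 : ℝ≥0∞) ^ k * a k
      ≤ (3 : ℝ≥0∞)⁻¹ * ∑' k : ℕ, (2 / 3 : ℝ≥0∞) ^ k * c := by
        gcongr; exact h _
    _ = c := by rw [ENNReal.tsum_mul_right, ← mul_assoc, weights, one_mul]

lemma weighted_eabs (a : ℕ → ℝ≥0∞) (c : ℝ≥0∞) :
    eabs ((3 : ℝ≥0∞)⁻¹ * ∑' k : ℕ, (2 / 3 : ℝ≥0∞) ^ k * a k) c ≤
    (3 : ℝ≥0∞)⁻¹ * ∑' k : ℕ, (2 / 3 : ℝ≥0∞) ^ k * eabs (a k) c := by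
  have hc : (3 : ℝ≥0∞)⁻¹ * ∑' k : ℕ, (2 / 3 : ℝ≥0∞) ^ k * c = c := by
    rw [ENNReal.tsum_mul_right, ← mul_assoc, weights, one_mul]
  rw [eabs_le_iff]
  constructor
  · refine le_trans ?_ (add_le_add_left hc.le _)
    rw [← mul_add, ← ENNReal.tsum_add]
    gcongr with k
    rw [← mul_add]
    gcongr
    exact le_add_eabs _ _
  · refine hc.ge.trans ?_
    rw [← mul_add, ← ENNReal.tsum_add]
    gcongr with k
    rw [← mul_add]
    gcongr
    exact le_add_eabs' _ _
end helpers

theorem statement15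
    {X : Type*} [MetricSpace X] [TopologicalSpace.SeparableSpace X] [ConnectedSpace X]
    [Nontrivial X] [MeasurableSpace X] [BorelSpace X]
    (hloc : ∀ x : X, ∃ r > 0, IsComplete (closedBall x r))
    (m : Measure X) [IsLocallyFiniteMeasure m] (hm : m ≠ 0)
    (p : ℝ) (hp : 1 ≤ p)
    (C_D : ℝ≥0) (hD : InternallyDoubling m C_D)
    (Ω : Set X) (hΩ : IsOpen Ω)
    (Y : Type*) [MetricSpace Y] (f : X → Y) (hf : MemB m Ω f)
    (E : Set X) (hEm : MeasurableSet E) (hE : WellInside E Ω)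
    (R_D : ℝ) (hRD : 0 < R_D) (hdbl : DoublingOn m C_D E R_D)
    (R : ℝ) (hR : 0 < R) (hR1 : R ≤ R_D / 16)
    (hR2 : ENNReal.ofReal (16 * R) ≤ compDist E Ω)
    (ν : OuterMeasure X) (hν : IsCheegerEnergy m p Ω f ν) :
    (ν Ω < ⊤ → ∀ r : ℝ, 0 < r → r ≤ R →
      (∫⁻ x in E, Aop m ν x r ∂m) ≤ (C_D : ℝ≥0∞) * ν (setBall E r) ∧
      (∫⁻ x in E, Rop m ν x r ∂m) ≤ (C_D : ℝ≥0∞) * ν (setBall E r)) ∧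
    (ν Ω < ⊤ → (∀ S, S ⊆ Ω → m S = 0 → ν S = 0) →
      ∀ G : X → ℝ≥0∞, Measurable G →
        (∀ A : Set X, A ⊆ Ω → MeasurableSet A → ν A = ∫⁻ x in A, G x ∂m) →
        Filter.Tendsto (fun r : ℝ => ∫⁻ x in E, eabs (Aop m ν x r) (G x) ∂m)
          (𝓝[>] (0:ℝ)) (𝓝 0) ∧
        Filter.Tendsto (fun r : ℝ => ∫⁻ x in E, eabs (Rop m ν x r) (G x) ∂m)
          (𝓝[>] (0:ℝ)) (𝓝 0)) ∧
    (ν Ω < ⊤ → ∀ r : ℝ, 0 < r → r ≤ R → ∀ᵐ x ∂m.restrict E, Mop m ν x r < ⊤) := by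
  have hΩm : MeasurableSet Ω := hΩ.measurableSet
  have : SecondCountableTopology X := UniformSpace.secondCountable_of_separable X
  -- points outside `Ω` are far from `E`
  have hfar : ∀ x ∈ E, ∀ y, dist y x < 16 * R → y ∈ Ω := by
    intro x hx y hy
    by_contra hyΩ
    have h1 : compDist E Ω ≤ edist (x : UniformSpace.Completion X) (y : UniformSpace.Completion X) := by
      refine iInf₂_le_of_le x hx (iInf₂_le_of_le (y : UniformSpace.Completion X) ?_ le_rfl)
      rintro ⟨a, ha, hay⟩
      exact hyΩ (UniformSpace.Completion.coe_injective X hay ▸ ha)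
    rw [UniformSpace.Completion.edist_eq, edist_dist, dist_comm] at h1
    have h2 := hR2.trans h1
    rw [ENNReal.ofReal_le_ofReal_iff dist_nonneg] at h2
    linarith
  have hballΩ : ∀ x ∈ E, ∀ r, r ≤ 8 * R → closedBall x r ⊆ Ω := by
    intro x hx r hr y hy
    rw [mem_closedBall] at hy
    exact hfar x hx y (by linarith)
  have hsetΩ : ∀ r, 0 ≤ r → r ≤ R → setBall E r ⊆ Ω := by
    intro r h0 hr y hy
    obtain ⟨x, hx, hd⟩ := exists_dist_of_mem_setBall h0 hy (show r < 16 * R by linarith)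
    exact hfar x hx y hd
  have hC : 1 ≤ C_D := hD.1
  set m' : Measure X := m.restrict Ω with hm'
  have hmB : ∀ x ∈ E, ∀ r, r ≤ 8 * R → m' (closedBall x r) = m (closedBall x r) := by
    intro x hx r hr
    exact Measure.restrict_eq_self _ (hballΩ x hx r hr)
  have hEr : m'.restrict E = m.restrict E := by
    rw [hm', Measure.restrict_restrict hEm, inter_eq_self_of_subset_left hE.1]
  have hdbl' : Dbl m' C_D E (8 * R) := by
    intro x hx r h0 hr
    have hxs : x ∈ setBall E R_D := mem_setBall_of_dist hx (by rw [dist_self]; exact hRD.le)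
    have d1 := hdbl x hxs r h0 (by linarith)
    have d2 := hdbl x hxs (r / 2) (by linarith) (by linarith)
    rw [show 2 * (r / 2) = r by ring] at d2
    rw [hmB x hx r hr]
    exact ⟨d2.1, (Measure.restrict_apply_le _ _).trans d1.2.1, d1.2.2⟩
  have hcar : ‹MeasurableSpace X› ≤ ν.caratheodory := hν.1.1
  set μ : Measure X := (ν.toMeasure hcar).restrict Ω with hμ
  have hμA : ∀ A, MeasurableSet A → A ⊆ Ω → μ A = ν A := by
    intro A hA hAΩ
    rw [hμ, Measure.restrict_eq_self _ hAΩ, toMeasure_apply _ _ hA]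
  have hAop : ∀ x ∈ E, ∀ r, 0 < r → r ≤ R → Aop m ν x r = Av m' μ x r := by
    intro x hx r h0 hr
    have h1 := (hdbl' x hx r h0 (by linarith)).1.ne'
    rw [hmB x hx r (by linarith)] at h1
    rw [Aop, if_neg h1, Av, hmB x hx r (by linarith),
      hμA _ isClosed_closedBall.measurableSet (hballΩ x hx r (by linarith))]
  have hhalf : ∀ r : ℝ, 0 < r → ∀ k : ℕ, 0 < r / 2 ^ k ∧ r / 2 ^ k ≤ r := by
    intro r h0 k
    exact ⟨by positivity, div_le_self h0.le (one_le_pow₀ (by norm_num))⟩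
  have hRop : ∀ x ∈ E, ∀ r, 0 < r → r ≤ R → Rop m ν x r =
      (3 : ℝ≥0∞)⁻¹ * ∑' k : ℕ, (2 / 3 : ℝ≥0∞) ^ k * Av m' μ x (r / 2 ^ k) := by
    intro x hx r h0 hr
    rw [Rop]
    congr 1
    refine tsum_congr fun k => ?_
    rw [hAop x hx _ (hhalf r h0 k).1 ((hhalf r h0 k).2.trans hr)]
  have hfinμ : ν Ω < ⊤ → IsFiniteMeasure μ := by
    intro h
    refine ⟨?_⟩
    rw [hμ, Measure.restrict_apply_univ, toMeasure_apply _ _ hΩm]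
    exact h
  refine ⟨?_, ?_, ?_⟩
  · intro hfin r h0 hr
    have := hfinμ hfin
    have hA : ∀ s, 0 < s → s ≤ r → ∫⁻ x in E, Av m' μ x s ∂m ≤ C_D * ν (setBall E r) := by
      intro s hs hsr
      rw [← hEr, ← hμA _ (isClosed_setBall E r).measurableSet (hsetΩ r h0.le hr)]
      refine (Av_L1 m' μ hC hEm hdbl' hs (by linarith)).trans ?_
      gcongr
      exact setBall_mono_right _ hsr
    constructor
    · rw [setLIntegral_congr_fun hEm fun x hx => hAop x hx r h0 hr]
      exact hA r h0 le_rfl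
    · rw [setLIntegral_congr_fun hEm fun x hx => hRop x hx r h0 hr]
      rw [lintegral_const_mul' _ _ (by finiteness), lintegral_tsum fun k =>
        ((measurable_Av m' μ _).const_mul _).aemeasurable]
      simp_rw [lintegral_const_mul _ (measurable_Av m' μ _)]
      exact weighted_le _ _ fun k => hA _ (hhalf r h0 k).1 (hhalf r h0 k).2
  · intro hfin _ G hG hνG
    have := hfinμ hfin
    have hμG : μ = m'.withDensity G := by
      ext A hA
      rw [withDensity_apply _ hA, hm', Measure.restrict_restrict hA, ← hνG _ inter_subset_right
        (hA.inter hΩm), hμ, Measure.restrict_apply hA, toMeasure_apply _ _ (hA.inter hΩm)]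
    have hGf : ∫⁻ x, G x ∂m' ≠ ⊤ := by
      rw [hm', ← hνG Ω le_rfl hΩm]
      exact hfin.ne
    have hconv := conv_A m' hC hEm hR hdbl' G hG hGf
    rw [← hμG, hEr] at hconv
    have hrR : ∀ᶠ r in 𝓝[>] (0 : ℝ), r < R := mem_nhdsWithin_of_mem_nhds (Iio_mem_nhds hR)
    constructor
    · refine hconv.congr' ?_
      filter_upwards [hrR, self_mem_nhdsWithin] with r hr h0
      exact setLIntegral_congr_fun hEm fun x hx => by
        simp only [hAop x hx r h0 hr.le]
    · rw [ENNReal.tendsto_nhds_zero] at hconv ⊢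
      intro ε hε
      have h1 := hconv ε hε
      rw [eventually_nhdsWithin_iff, Metric.eventually_nhds_iff] at h1
      obtain ⟨δ, hδ, h1⟩ := h1
      have hrδ : ∀ᶠ r in 𝓝[>] (0 : ℝ), r < δ := mem_nhdsWithin_of_mem_nhds (Iio_mem_nhds hδ)
      filter_upwards [hrR, hrδ, self_mem_nhdsWithin] with r hr hrδ h0
      have h0 : 0 < r := h0
      have hm1 : ∀ s, Measurable fun x => eabs (Av m' μ x s) (G x) := fun s =>
        measurable_eabs (measurable_Av m' μ s) hG
      calc ∫⁻ x in E, eabs (Rop m ν x r) (G x) ∂m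
          ≤ ∫⁻ x in E, (3 : ℝ≥0∞)⁻¹ * ∑' k : ℕ, (2 / 3 : ℝ≥0∞) ^ k *
              eabs (Av m' μ x (r / 2 ^ k)) (G x) ∂m := by
            refine setLIntegral_mono' hEm fun x hx => ?_
            rw [hRop x hx r h0 hr.le]
            exact weighted_eabs _ _
        _ = (3 : ℝ≥0∞)⁻¹ * ∑' k : ℕ, (2 / 3 : ℝ≥0∞) ^ k *
              ∫⁻ x in E, eabs (Av m' μ x (r / 2 ^ k)) (G x) ∂m := by
            rw [lintegral_const_mul' _ _ (by finiteness), lintegral_tsum fun k =>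
              ((hm1 _).const_mul _).aemeasurable]
            simp_rw [lintegral_const_mul _ (hm1 _)]
        _ ≤ ε := by
            refine weighted_le _ _ fun k => ?_
            obtain ⟨a, b⟩ := hhalf r h0 k
            refine h1 ?_ a
            rw [Real.dist_eq, sub_zero, abs_of_pos a]
            linarith
  · intro hfin r h0 hr
    have := hfinμ hfin
    have h1 := max_finite m' μ hEm (R := r) (fun x hx s hs hsr => hdbl' x hx s hs (by linarith))
    rw [hEr, ae_restrict_iff' hEm] at h1
    rw [ae_restrict_iff' hEm]
    filter_upwards [h1] with x hx hxE
    refine lt_of_le_of_lt ?_ (hx hxE)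
    refine iSup₂_mono fun s hs => ?_
    rw [hAop x hxE s hs.1 (hs.2.trans hr)]

end BBM
end
end
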